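/- arXiv:1402.4282 — 9 statements merged into one kernel-verified Lean document; each statement's English description precedes it below -/
import Mathlib

section
/- Let X be a Hausdorff topological space which contains an uncountable closed discrete subset. Then the ordinal space ω₁ (with its order topology) embeds into (CL(X), τ_F) as a closed subspace; that is, there is a map from ω₁ to CL(X) which is a closed embedding with respect to the Fell topology. -/
open Set Topology Ordinal

noncomputable section

/-- `CL X` is the hyperspace of nonempty closed subsets of `X`. -/
def CL (X : Type*) [TopologicalSpace X] : Type _ := {A : Set X // A.Nonempty ∧ IsClosed A}

/-- The Fell topology on `CL X`, generated by the subbase consisting of the sets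
`U⁻ = {A : A ∩ U ≠ ∅}` for `U` open and `(Kᶜ)⁺ = {A : A ⊆ Kᶜ}` for `K` compact. -/
def fellTopology (X : Type*) [TopologicalSpace X] : TopologicalSpace (CL X) :=
  TopologicalSpace.generateFrom
    ({S | ∃ U : Set X, IsOpen U ∧ S = {A : CL X | (A.1 ∩ U).Nonempty}} ∪
     {S | ∃ K : Set X, IsCompact K ∧ S = {A : CL X | A.1 ⊆ Kᶜ}})

/-- A set all of whose subsets are closed meets every compact set in a finite set. -/
theorem IsCompact.finite_inter_of_forall_subset_isClosed {X : Type*} [TopologicalSpace X]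
    {K D : Set X} (hK : IsCompact K) (hD : ∀ S ⊆ D, IsClosed S) : (K ∩ D).Finite := by
  refine (hK.inter_right (hD D Subset.rfl)).finite ?_
  rw [isDiscrete_iff_discreteTopology, discreteTopology_iff_forall_isClosed]
  intro S
  rw [← Subtype.val_injective.preimage_image S]
  refine (hD _ ?_).preimage continuous_subtype_val
  rintro _ ⟨x, -, rfl⟩
  exact x.2.2

/-- Every subset of a closed discrete set is closed. -/
theorem IsClosed.isClosed_of_subset_of_discreteTopology {X : Type*} [TopologicalSpace X]
    {D S : Set X} (hD : IsClosed D) (hd : DiscreteTopology D) (hS : S ⊆ D) : IsClosed S := by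
  have h := hD.isClosedEmbedding_subtypeVal.isClosedMap _
    (isClosed_discrete ((↑) ⁻¹' S : Set D))
  rwa [Subtype.image_preimage_coe, inter_eq_right.2 hS] at h

/-- The set `{e b : a ≤ b}` as a point of the hyperspace `CL X`. -/
def CL.tail {X I : Type*} [TopologicalSpace X] [Preorder I] (e : I → X)
    (he : ∀ S : Set I, IsClosed (e '' S)) (a : I) : CL X :=
  ⟨e '' Ici a, ⟨e a, a, self_mem_Ici, rfl⟩, he _⟩

/-- Removing the images of all points other than `b` isolates `e b` within the range of `e`. -/
theorem mem_compl_image_compl_singleton_iff {X I : Type*} {e : I → X} (hinj : e.Injective) {b c : I} :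
    e c ∈ (e '' {b}ᶜ)ᶜ ↔ c = b := by
  simp [hinj.eq_iff]

section Tail

variable {X I : Type*} [TopologicalSpace X] [LinearOrder I] {e : I → X}

theorem CL.isOpen_hit {U : Set X} (hU : IsOpen U) :
    IsOpen[fellTopology X] {A : CL X | (A.1 ∩ U).Nonempty} :=
  TopologicalSpace.isOpen_generateFrom_of_mem (Or.inl ⟨U, hU, rfl⟩)

theorem CL.isOpen_miss {K : Set X} (hK : IsCompact K) :
    IsOpen[fellTopology X] {A : CL X | A.1 ⊆ Kᶜ} :=
  TopologicalSpace.isOpen_generateFrom_of_mem (Or.inr ⟨K, hK, rfl⟩)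

theorem CL.tail_inter_nonempty_iff (he : ∀ S : Set I, IsClosed (e '' S)) {a : I} {U : Set X} :
    ((CL.tail e he a).1 ∩ U).Nonempty ↔ ∃ b, a ≤ b ∧ e b ∈ U := by
  constructor
  · rintro ⟨_, ⟨b, hb, rfl⟩, h⟩
    exact ⟨b, hb, h⟩
  · rintro ⟨b, hb, h⟩
    exact ⟨e b, ⟨b, hb, rfl⟩, h⟩

theorem CL.tail_subset_compl_iff (he : ∀ S : Set I, IsClosed (e '' S)) {a : I} {K : Set X} :
    (CL.tail e he a).1 ⊆ Kᶜ ↔ ∀ b, e b ∈ K → b < a := by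
  constructor
  · intro h b hb
    by_contra! hab
    exact h ⟨b, hab, rfl⟩ hb
  · rintro h _ ⟨b, hb, rfl⟩ hK
    exact (h b hK).not_ge hb

theorem CL.continuous_tail [TopologicalSpace I] [OrderTopology I]
    (hI : ∀ a : I, IsOpen (Iic a)) (hinj : e.Injective)
    (he : ∀ S : Set I, IsClosed (e '' S)) :
    @Continuous _ _ _ (fellTopology X) (CL.tail e he) := by
  refine continuous_generateFrom_iff.2 ?_
  rintro _ (⟨U, -, rfl⟩ | ⟨K, hK, rfl⟩)
  · have : CL.tail e he ⁻¹' {A : CL X | (A.1 ∩ U).Nonempty} = ⋃ b ∈ e ⁻¹' U, Iic b := by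
      ext a
      simp only [mem_preimage, mem_ofPred_eq, CL.tail_inter_nonempty_iff, mem_iUnion, mem_Iic,
        exists_prop, and_comm]
    rw [this]
    exact isOpen_biUnion fun b _ ↦ hI b
  · have hfin : (e ⁻¹' K).Finite := by
      have h := hK.finite_inter_of_forall_subset_isClosed (D := range e) fun S hS ↦ by
        rw [← image_preimage_eq_of_subset hS]
        exact he _
      exact (h.preimage hinj.injOn).subset fun b hb ↦ ⟨hb, b, rfl⟩
    have : CL.tail e he ⁻¹' {A : CL X | A.1 ⊆ Kᶜ} = ⋂ b ∈ e ⁻¹' K, Ioi b := by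
      ext a
      simp only [mem_preimage, mem_ofPred_eq, CL.tail_subset_compl_iff, mem_iInter, mem_Ioi]
    rw [this]
    exact hfin.isOpen_biInter fun b _ ↦ isOpen_Ioi

theorem CL.isEmbedding_tail [TopologicalSpace I] [OrderTopology I]
    (hI : ∀ a : I, IsOpen (Iic a)) (hinj : e.Injective)
    (he : ∀ S : Set I, IsClosed (e '' S)) :
    @IsEmbedding _ _ _ (fellTopology X) (CL.tail e he) := by
  let := fellTopology X
  have hIoi (b : I) : CL.tail e he ⁻¹' {A : CL X | A.1 ⊆ {e b}ᶜ} = Ioi b := by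
    ext a
    rw [mem_preimage, mem_ofPred_eq, CL.tail_subset_compl_iff]
    simp [hinj.eq_iff]
  have hIic (b : I) :
      CL.tail e he ⁻¹' {A : CL X | (A.1 ∩ (e '' {b}ᶜ)ᶜ).Nonempty} = Iic b := by
    ext a
    simp only [mem_preimage, mem_ofPred_eq, CL.tail_inter_nonempty_iff,
      mem_compl_image_compl_singleton_iff hinj, exists_eq_right, mem_Iic]
  refine ⟨⟨le_antisymm (CL.continuous_tail hI hinj he).le_induced ?_⟩, ?_⟩
  · rw [OrderTopology.topology_eq_generate_intervals (α := I)]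
    refine le_generateFrom ?_
    let : TopologicalSpace I := .induced (CL.tail e he) (fellTopology X)
    rintro _ ⟨a, rfl | rfl⟩
    · exact ⟨_, CL.isOpen_miss isCompact_singleton, hIoi a⟩
    · have : Iio a = ⋃ b ∈ Iio a, Iic b := by
        ext c
        simp only [mem_Iio, mem_iUnion, mem_Iic, exists_prop]
        exact ⟨fun h ↦ ⟨c, h, le_rfl⟩, fun ⟨b, hb, hc⟩ ↦ hc.trans_lt hb⟩
      change IsOpen (Iio a)
      rw [this]
      exact isOpen_biUnion fun b _ ↦ ⟨_, CL.isOpen_hit (he {b}ᶜ).isOpen_compl, hIic b⟩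
  · have key (a b : I) (hab : CL.tail e he a = CL.tail e he b) : b ≤ a := by
      rw [← mem_Iic, ← hIic a, mem_preimage, ← hab]
      exact (hIic a).ge self_mem_Iic
    exact fun a b hab ↦ le_antisymm (key b a hab.symm) (key a b hab)

theorem CL.isClosed_range_tail [WellFoundedLT I] (hinj : e.Injective)
    (he : ∀ S : Set I, IsClosed (e '' S)) :
    @IsClosed _ (fellTopology X) (range (CL.tail e he)) := by
  let := fellTopology X
  refine isClosed_of_closure_subset fun A hA ↦ ?_
  rw [mem_closure_iff] at hA
  have hrange : A.1 ⊆ range e := by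
    intro x hx
    by_contra hxe
    obtain ⟨_, hB, a, rfl⟩ := hA _
      (CL.isOpen_hit (he univ).isOpen_compl) ⟨x, hx, by rwa [image_univ]⟩
    obtain ⟨b, -, hb⟩ := (CL.tail_inter_nonempty_iff he).1 hB
    exact hb ⟨b, mem_univ b, rfl⟩
  have hup (b c : I) (hb : e b ∈ A.1) (hbc : b ≤ c) : e c ∈ A.1 := by
    by_contra hc
    obtain ⟨_, ⟨hB, hC⟩, a, rfl⟩ := hA _
      ((CL.isOpen_hit (he {b}ᶜ).isOpen_compl).inter
        (CL.isOpen_miss (isCompact_singleton (x := e c))))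
      ⟨⟨e b, hb, (mem_compl_image_compl_singleton_iff hinj).2 rfl⟩,
        subset_compl_singleton_iff.2 hc⟩
    obtain ⟨d, had, hd⟩ := (CL.tail_inter_nonempty_iff he).1 hB
    rw [mem_compl_image_compl_singleton_iff hinj] at hd
    subst hd
    exact ((CL.tail_subset_compl_iff he).1 hC c rfl).not_ge (had.trans hbc)
  obtain ⟨x, hx⟩ := A.2.1
  obtain ⟨c, rfl⟩ := hrange hx
  obtain ⟨m, hm, hmin⟩ := WellFounded.has_min (wellFounded_lt (α := I)) (e ⁻¹' A.1) ⟨c, hx⟩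
  refine ⟨m, Subtype.ext (Subset.antisymm ?_ ?_)⟩
  · rintro _ ⟨b, hb, rfl⟩
    exact hup m b hm hb
  · intro y hy
    obtain ⟨b, rfl⟩ := hrange hy
    exact ⟨b, not_lt.1 (hmin b hy), rfl⟩

end Tail

/-- An uncountable set contains an injective image of the set of countable ordinals. -/
theorem exists_injective_Iio_omega_one.{u, v} {X : Type u} {D : Set X} (hD : ¬ D.Countable) :
    ∃ e : Iio (ω₁ : Ordinal.{v}) → X, e.Injective ∧ range e ⊆ D := by
  have h : Cardinal.lift.{u} (Cardinal.mk (Iio (ω₁ : Ordinal.{v}))) ≤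
      Cardinal.lift.{v + 1} (Cardinal.mk D) := by
    rw [← Cardinal.le_aleph0_iff_set_countable, not_le] at hD
    simpa [Cardinal.mk_Iio_ordinal, Cardinal.aleph_one_le_iff] using hD
  obtain ⟨g⟩ := Cardinal.lift_mk_le'.1 h
  refine ⟨fun a ↦ g a, Subtype.val_injective.comp g.injective, ?_⟩
  rintro _ ⟨a, rfl⟩
  exact (g a).2

/-- If a Hausdorff space `X` contains an uncountable closed discrete subset, then the
ordinal space `ω₁` embeds into `(CL X, τ_F)` as a closed subspace. -/
theorem omega1_closedEmbedding_fell {X : Type*} [TopologicalSpace X] [T2Space X]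
    (D : Set X) (hD_unc : ¬ D.Countable) (hD_closed : IsClosed D)
    (hD_disc : DiscreteTopology D) :
    ∃ f : {o : Ordinal // o < ω₁} → CL X,
      @IsClosedEmbedding _ _ _ (fellTopology X) f := by
  obtain ⟨e, hinj, hrange⟩ := exists_injective_Iio_omega_one hD_unc
  have he (S : Set (Iio (ω₁ : Ordinal))) : IsClosed (e '' S) :=
    hD_closed.isClosed_of_subset_of_discreteTopology hD_disc
      ((image_subset_range e S).trans hrange)
  have hI (a : Iio (ω₁ : Ordinal)) : IsOpen (Iic a) := by
    have : Iic a = (↑) ⁻¹' Iio (Order.succ a.1) := by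
      ext b
      simp
    rw [this]
    exact isOpen_Iio.preimage continuous_subtype_val
  let := fellTopology X
  exact ⟨CL.tail e he, CL.isEmbedding_tail hI hinj he, CL.isClosed_range_tail hinj he⟩
end
end

section
/- Let X be a Hausdorff topological space which contains an uncountable closed discrete subset. Then the ordinal space ω₁ + 1 (with its order topology) embeds into (CL(X), τ_F) as a closed subspace; that is, there is a map from ω₁ + 1 to CL(X) which is a closed embedding with respect to the Fell topology. -/
open Set Topology Ordinal

noncomputable section

namespace CL

variable {X : Type*} [TopologicalSpace X]

theorem isOpen_hit_s1 {U : Set X} (hU : IsOpen U) :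
    IsOpen[fellTopology X] {A : CL X | (A.1 ∩ U).Nonempty} :=
  TopologicalSpace.isOpen_generateFrom_of_mem (Or.inl ⟨U, hU, rfl⟩)

theorem isOpen_miss_s1 {K : Set X} (hK : IsCompact K) :
    IsOpen[fellTopology X] {A : CL X | A.1 ⊆ Kᶜ} :=
  TopologicalSpace.isOpen_generateFrom_of_mem (Or.inr ⟨K, hK, rfl⟩)

variable {I : Type*} {D : Set X} {g : I → X}

theorem isClosed_of_subset_closed_discrete (hDc : IsClosed D) (hDd : DiscreteTopology D)
    {S : Set X} (hS : S ⊆ D) : IsClosed S := by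
  have h := hDc.isClosedEmbedding_subtypeVal.isClosedMap (Subtype.val ⁻¹' S) (isClosed_discrete _)
  rwa [Subtype.image_preimage_coe, inter_eq_right.mpr hS] at h

/-- The image of the final segment starting at `a`, as a point of the hyperspace. -/
def imageIci [Preorder I] (hDc : IsClosed D) (hDd : DiscreteTopology D)
    (hgD : ∀ i, g i ∈ D) (a : I) : CL X :=
  ⟨g '' Ici a, ⟨g a, a, self_mem_Ici, rfl⟩,
    isClosed_of_subset_closed_discrete hDc hDd (image_subset_iff.mpr fun i _ => hgD i)⟩

theorem exists_isOpen_forall_mem_iff (hDd : DiscreteTopology D) (hgD : ∀ i, g i ∈ D)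
    (hg : g.Injective) (c : I) : ∃ U : Set X, IsOpen U ∧ ∀ i, g i ∈ U ↔ i = c := by
  obtain ⟨U, hU, hUc⟩ := isOpen_induced_iff.mp (isOpen_discrete ({⟨g c, hgD c⟩} : Set D))
  refine ⟨U, hU, fun i => ?_⟩
  have h := Set.ext_iff.mp hUc ⟨g i, hgD i⟩
  simpa [hg.eq_iff] using h

theorem isOpen_Iic_of_wellFoundedLT [LinearOrder I] [WellFoundedLT I] [TopologicalSpace I]
    [OrderTopology I] (b : I) : IsOpen (Iic b) := by
  by_cases h : (Ioi b).Nonempty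
  · obtain ⟨c, hbc, hc⟩ := WellFounded.has_min (wellFounded_lt (α := I)) (Ioi b) h
    have : Iic b = Iio c := by
      ext x
      exact ⟨fun hx => lt_of_le_of_lt hx hbc, fun hx => not_lt.mp fun hbx => hc x hbx hx⟩
    exact this ▸ isOpen_Iio
  · have : Iic b = Set.univ := eq_univ_of_forall fun x => not_lt.mp fun hx => h ⟨x, hx⟩
    exact this ▸ isOpen_univ

variable [LinearOrder I]

theorem imageIci_hit_iff (hDc : IsClosed D) (hDd : DiscreteTopology D) (hgD : ∀ i, g i ∈ D)
    (a : I) (U : Set X) :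
    ((imageIci hDc hDd hgD a).1 ∩ U).Nonempty ↔ ∃ b, g b ∈ U ∧ a ≤ b := by
  simp only [imageIci, Set.Nonempty, mem_inter_iff, mem_image, mem_Ici]
  grind

theorem imageIci_miss_iff (hDc : IsClosed D) (hDd : DiscreteTopology D) (hgD : ∀ i, g i ∈ D)
    (a : I) (K : Set X) :
    (imageIci hDc hDd hgD a).1 ⊆ Kᶜ ↔ ∀ b, g b ∈ K → b < a := by
  simp only [imageIci, image_subset_iff]
  refine forall_congr' fun b => ?_
  rw [mem_Ici, mem_preimage, mem_compl_iff, imp_not_comm, not_le]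

variable [WellFoundedLT I] [TopologicalSpace I] [OrderTopology I]

theorem continuous_imageIci (hDc : IsClosed D) (hDd : DiscreteTopology D) (hgD : ∀ i, g i ∈ D)
    (hg : g.Injective) :
    @Continuous _ _ _ (fellTopology X) (imageIci (I := I) hDc hDd hgD) := by
  refine continuous_generateFrom_iff.mpr ?_
  rintro _ (⟨U, -, rfl⟩ | ⟨K, hK, rfl⟩)
  · have : imageIci (I := I) hDc hDd hgD ⁻¹' {A : CL X | (A.1 ∩ U).Nonempty} =
        ⋃ b ∈ g ⁻¹' U, Iic b := by
      ext a
      simp [imageIci_hit_iff]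
    rw [this]
    exact isOpen_biUnion fun b _ => isOpen_Iic_of_wellFoundedLT b
  · have : imageIci (I := I) hDc hDd hgD ⁻¹' {A : CL X | A.1 ⊆ Kᶜ} =
        ⋂ b ∈ g ⁻¹' K, Ioi b := by
      ext a
      simp [imageIci_miss_iff]
    rw [this]
    have hfin : (K ∩ D).Finite := (hK.inter_right hDc).finite
      ((isDiscrete_iff_discreteTopology.mpr hDd).mono inter_subset_right)
    refine Set.Finite.isOpen_biInter ?_ fun b _ => isOpen_Ioi
    exact (hfin.preimage hg.injOn).subset fun b hb => ⟨hb, hgD b⟩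

/-- The final segments of a well-ordered injective family in a closed discrete set form a closed
copy of the index set in the Fell hyperspace. -/
theorem isClosedEmbedding_imageIci (hDc : IsClosed D) (hDd : DiscreteTopology D)
    (hgD : ∀ i, g i ∈ D) (hg : g.Injective) :
    @IsClosedEmbedding _ _ _ (fellTopology X) (imageIci (I := I) hDc hDd hgD) := by
  let := fellTopology X
  have hlt (b a : I) : (imageIci hDc hDd hgD a).1 ⊆ {g b}ᶜ ↔ b < a := by
    rw [imageIci_miss_iff]
    simp [hg.eq_iff]
  choose U hUo hU using exists_isOpen_forall_mem_iff hDd hgD hg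
  have hle (b a : I) : ((imageIci hDc hDd hgD a).1 ∩ U b).Nonempty ↔ a ≤ b := by
    simp [imageIci_hit_iff, hU]
  refine ⟨⟨⟨le_antisymm (continuous_iff_le_induced.mp (continuous_imageIci hDc hDd hgD hg)) ?_⟩,
    ?_⟩, ?_⟩
  · rw [OrderTopology.topology_eq_generate_intervals (α := I)]
    refine le_generateFrom ?_
    let := TopologicalSpace.induced (imageIci (I := I) hDc hDd hgD) (fellTopology X)
    rintro _ ⟨b, rfl | rfl⟩
    · exact isOpen_induced_iff.mpr ⟨_, isOpen_miss_s1 (isCompact_singleton (x := g b)),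
        Set.ext fun a => hlt b a⟩
    · have : Iio b = ⋃ c ∈ Iio b, imageIci (I := I) hDc hDd hgD ⁻¹'
          {A : CL X | (A.1 ∩ U c).Nonempty} := by
        ext a
        simp only [mem_Iio, mem_iUnion, mem_preimage, mem_ofPred_eq, hle, exists_prop]
        exact ⟨fun h => ⟨a, h, le_rfl⟩, fun ⟨c, hc, hac⟩ => hac.trans_lt hc⟩
      rw [this]
      exact isOpen_biUnion fun c _ => isOpen_induced_iff.mpr ⟨_, isOpen_hit_s1 (hUo c), rfl⟩
  · intro a b hab
    refine eq_of_forall_lt_iff fun c => ?_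
    rw [← hlt, ← hlt, hab]
  · rw [← isOpen_compl_iff, isOpen_iff_forall_mem_open]
    intro B hB
    by_cases hBD : B.1 ⊆ range g
    · have hne : (g ⁻¹' B.1).Nonempty := by
        obtain ⟨x, hx⟩ := B.2.1
        obtain ⟨i, rfl⟩ := hBD hx
        exact ⟨i, hx⟩
      obtain ⟨m, hmB, hm⟩ := WellFounded.has_min (wellFounded_lt (α := I)) _ hne
      obtain ⟨b, hmb, hb⟩ : ∃ b, m ≤ b ∧ g b ∉ B.1 := by
        by_contra! h
        refine hB ⟨m, Subtype.ext (Subset.antisymm (image_subset_iff.mpr h) fun x hx => ?_)⟩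
        obtain ⟨i, rfl⟩ := hBD hx
        exact mem_image_of_mem g (not_lt.mp (hm i hx))
      refine ⟨_, ?_, (isOpen_hit_s1 (hUo m)).inter (isOpen_miss_s1 (isCompact_singleton (x := g b))),
        ⟨g m, hmB, (hU m m).mpr rfl⟩, subset_compl_singleton_iff.mpr hb⟩
      rintro _ ⟨h1, h2⟩ ⟨a, rfl⟩
      exact (((hle m a).mp h1).trans hmb).not_gt ((hlt b a).mp h2)
    · obtain ⟨x, hxB, hx⟩ := not_subset.mp hBD
      have hr : IsClosed (range g) :=
        isClosed_of_subset_closed_discrete hDc hDd (range_subset_iff.mpr hgD)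
      refine ⟨_, ?_, isOpen_hit_s1 hr.isOpen_compl, ⟨x, hxB, hx⟩⟩
      rintro _ ⟨y, hy, hyr⟩ ⟨a, rfl⟩
      exact hyr (image_subset_range _ _ hy)

end CL

theorem nonempty_embedding_of_uncountable {X : Type*} {D : Set X} (hD : ¬ D.Countable) :
    Nonempty ({o : Ordinal // o ≤ ω₁} ↪ D) := by
  rw [← Cardinal.lift_mk_le']
  have h0 : Cardinal.mk (Iio ((ω₁ : Ordinal) + 1)) ≤ Cardinal.aleph 1 := by
    rw [Cardinal.mk_Iio_ordinal, card_add_one, card_omega,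
      Cardinal.add_one_eq (Cardinal.aleph0_le_aleph 1)]
    simp
  have hsub : Iic (ω₁ : Ordinal) ⊆ Iio (ω₁ + 1) := fun _ ho =>
    mem_Iio.mpr (Order.lt_add_one_iff.mpr (mem_Iic.mp ho))
  have h1 : Cardinal.mk {o : Ordinal // o ≤ ω₁} ≤ Cardinal.aleph 1 :=
    (Cardinal.mk_le_mk_of_subset hsub).trans h0
  have h2 : Cardinal.aleph 1 ≤ Cardinal.mk D := by
    rw [Cardinal.aleph_one_le_iff, ← not_le, Cardinal.le_aleph0_iff_set_countable]
    exact hD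
  refine (Cardinal.lift_le.mpr h1).trans (le_trans ?_ (Cardinal.lift_le.mpr h2))
  simp

/-- If a Hausdorff space `X` contains an uncountable closed discrete subset, then the
ordinal space `ω₁ + 1` embeds into `(CL X, τ_F)` as a closed subspace. -/
theorem omega1_succ_closedEmbedding_fell {X : Type*} [TopologicalSpace X] [T2Space X]
    (D : Set X) (hD_unc : ¬ D.Countable) (hD_closed : IsClosed D)
    (hD_disc : DiscreteTopology D) :
    ∃ f : {o : Ordinal // o ≤ ω₁} → CL X,
      @IsClosedEmbedding _ _ _ (fellTopology X) f := by
  obtain ⟨e⟩ := nonempty_embedding_of_uncountable hD_unc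
  have : OrderTopology {o : Ordinal // o ≤ ω₁} :=
    inferInstanceAs (OrderTopology (Iic (ω₁ : Ordinal)))
  exact ⟨_, CL.isClosedEmbedding_imageIci hD_closed hD_disc (g := fun o => (e o : X))
    (fun o => (e o).2) (Subtype.val_injective.comp e.injective)⟩
end
end

section
/- Let X be a Hausdorff topological space and let x : ω₁ → X be an injective map whose range D = {x_α : α < ω₁} is a closed discrete subset of X. Define E₀ = X and E_α = {x_η : α ≤ η < ω₁} for 0 < α < ω₁, and define φ : ω₁ → CL(X) by φ(α) = E_α. Then φ is continuous from the order topology on ω₁ to the Fell topology τ_F on CL(X). -/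
open Set Topology Ordinal

noncomputable section

/-- Lower sets of an initial segment of the ordinals are open. -/
theorem isOpen_of_isLowerSet_ordinal_subtype {b : Ordinal} {s : Set {o : Ordinal // o < b}}
    (hs : IsLowerSet s) : IsOpen s := by
  refine isOpen_iff_mem_nhds.2 fun α hα => ?_
  have hopen : IsOpen {β : {o : Ordinal // o < b} | β.1 < Order.succ α.1} :=
    isOpen_Iio.preimage continuous_subtype_val
  filter_upwards [hopen.mem_nhds (Order.lt_succ α.1)] with β hβ
  exact hs (Order.lt_succ_iff.1 hβ : β.1 ≤ α.1) hα

/-- Let `x : ω₁ → X` be injective with closed discrete range, `E₀ = X` and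
`E_α = {x_η : α ≤ η < ω₁}` for `0 < α < ω₁`. Then `φ : α ↦ E_α` is continuous
from the order topology on `ω₁` to the Fell topology on `CL X`. -/
theorem phi_continuous_fell {X : Type*} [TopologicalSpace X] [T2Space X]
    (x : Ordinal → X) (hx_inj : Set.InjOn x (Set.Iio ω₁))
    (hD_closed : IsClosed (x '' Set.Iio ω₁))
    (hD_disc : DiscreteTopology (x '' Set.Iio ω₁))
    (φ : {o : Ordinal // o < ω₁} → CL X)
    (hφ_zero : ∀ α : {o : Ordinal // o < ω₁}, α.1 = 0 → (φ α).1 = Set.univ)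
    (hφ_pos : ∀ α : {o : Ordinal // o < ω₁}, α.1 ≠ 0 →
      (φ α).1 = x '' Set.Ico α.1 ω₁) :
    @Continuous _ _ _ (fellTopology X) φ := by
  have hanti : ∀ α β, α ≤ β → (φ β).1 ⊆ (φ α).1 := by
    intro α β hαβ
    by_cases hα : α.1 = 0
    · rw [hφ_zero α hα]
      exact subset_univ _
    · have hβ : β.1 ≠ 0 := fun h => hα (le_antisymm (h ▸ hαβ) zero_le)
      rw [hφ_pos α hα, hφ_pos β hβ]
      exact image_mono (Ico_subset_Ico_left hαβ)
  refine continuous_generateFrom_iff.2 ?_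
  rintro S (⟨U, -, rfl⟩ | ⟨K, hK, rfl⟩)
  · exact isOpen_of_isLowerSet_ordinal_subtype fun β α hαβ hβ =>
      hβ.mono (inter_subset_inter_left _ (hanti α β hαβ))
  · have hfin : {η | η < ω₁ ∧ x η ∈ K}.Finite := by
      have hD : (K ∩ x '' Iio ω₁).Finite :=
        (hK.inter_right hD_closed).finite ((isDiscrete_iff_discreteTopology.2 hD_disc).mono
          inter_subset_right)
      refine Finite.of_finite_image (f := x) (hD.subset ?_) (hx_inj.mono fun η hη => hη.1)
      rintro _ ⟨η, ⟨hη, hηK⟩, rfl⟩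
      exact ⟨hηK, η, hη, rfl⟩
    rcases K.eq_empty_or_nonempty with rfl | ⟨k, hk⟩
    · simp
    have hclosed : IsClosed ({α : {o : Ordinal // o < ω₁} | α.1 ≤ 0} ∪
        ⋃ η ∈ {η | η < ω₁ ∧ x η ∈ K}, {α : {o : Ordinal // o < ω₁} | α.1 ≤ η}) :=
      (isClosed_Iic.preimage continuous_subtype_val).union
        (hfin.isClosed_biUnion fun η _ => isClosed_Iic.preimage continuous_subtype_val)
    convert hclosed.isOpen_compl using 1
    ext α
    simp only [mem_preimage, mem_ofPred_eq, mem_compl_iff, mem_union, mem_iUnion, not_or,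
      not_exists]
    constructor
    · intro h
      have hα : α.1 ≠ 0 := fun h0 => h (hφ_zero α h0 ▸ mem_univ k) hk
      rw [hφ_pos α hα] at h
      exact ⟨fun h0 => hα (le_antisymm h0 zero_le),
        fun η hη hle => h ⟨η, ⟨hle, hη.1⟩, rfl⟩ hη.2⟩
    · rintro ⟨h0, h⟩
      rw [hφ_pos α fun hα => h0 hα.le]
      rintro _ ⟨η, ⟨hle, hη⟩, rfl⟩ hηK
      exact h η ⟨hη, hηK⟩ hle
end
end

section
/- Let X be a Hausdorff topological space and let x : ω₁ → X be an injective map whose range D = {x_α : α < ω₁} is a closed discrete subset of X. Define E₀ = X and E_α = {x_η : α ≤ η < ω₁} for 0 < α < ω₁, and define φ : ω₁ → CL(X) by φ(α) = E_α. Then φ is an open map onto its image; that is, for every open subset V of ω₁ (with the order topology), φ(V) is open in the subspace φ(ω₁) of (CL(X), τ_F). -/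
open Set Topology Ordinal

noncomputable section

theorem isOpen_fellTopology_hit {X : Type*} [TopologicalSpace X] {U : Set X} (hU : IsOpen U) :
    IsOpen[fellTopology X] {A : CL X | (A.1 ∩ U).Nonempty} :=
  .basic _ (.inl ⟨U, hU, rfl⟩)

theorem isOpen_fellTopology_miss {X : Type*} [TopologicalSpace X] {K : Set X}
    (hK : IsCompact K) : IsOpen[fellTopology X] {A : CL X | A.1 ⊆ Kᶜ} :=
  .basic _ (.inr ⟨K, hK, rfl⟩)

/-- Let `x : ω₁ → X` be injective with closed discrete range, `E₀ = X` and
`E_α = {x_η : α ≤ η < ω₁}` for `0 < α < ω₁`. Then `φ : α ↦ E_α` is an open map onto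
its image: for every open `V ⊆ ω₁`, `φ(V)` is open in the subspace `φ(ω₁)` of
`(CL X, τ_F)`. -/
theorem phi_isOpenMap_onto_image_fell {X : Type*} [TopologicalSpace X] [T2Space X]
    (x : Ordinal → X) (hx_inj : Set.InjOn x (Set.Iio ω₁))
    (hD_closed : IsClosed (x '' Set.Iio ω₁))
    (hD_disc : DiscreteTopology (x '' Set.Iio ω₁))
    (φ : {o : Ordinal // o < ω₁} → CL X)
    (hφ_zero : ∀ α : {o : Ordinal // o < ω₁}, α.1 = 0 → (φ α).1 = Set.univ)
    (hφ_pos : ∀ α : {o : Ordinal // o < ω₁}, α.1 ≠ 0 →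
      (φ α).1 = x '' Set.Ico α.1 ω₁) :
    ∀ V : Set {o : Ordinal // o < ω₁}, IsOpen V →
      @IsOpen (Set.range φ)
        (TopologicalSpace.induced (Subtype.val : Set.range φ → CL X) (fellTopology X))
        {A : Set.range φ | (A : CL X) ∈ φ '' V} := by
  intro V hV
  have mem_phi {β : {o : Ordinal // o < ω₁}} {γ : Ordinal} (hγ : γ < ω₁) :
      x γ ∈ (φ β).1 ↔ β.1 ≤ γ := by
    by_cases h0 : β.1 = 0
    · simp [hφ_zero β h0, h0]
    · rw [hφ_pos β h0]
      refine ⟨?_, fun h ↦ ⟨γ, ⟨h, hγ⟩, rfl⟩⟩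
      rintro ⟨η, ⟨hβη, hη⟩, hxη⟩
      exact hx_inj hη hγ hxη ▸ hβη
  have hit (α β : {o : Ordinal // o < ω₁}) (hs : Order.succ α.1 < ω₁) :
      ((φ β).1 ∩ (φ ⟨Order.succ α.1, hs⟩).1ᶜ).Nonempty ↔ β ≤ α := by
    constructor
    · rintro ⟨y, hy, hy'⟩
      by_contra h
      have hlt : α.1 < β.1 := not_le.1 h
      have hβ0 : β.1 ≠ 0 := (bot_le.trans_lt hlt).ne'
      rw [hφ_pos β hβ0] at hy
      obtain ⟨η, ⟨hβη, hη⟩, rfl⟩ := hy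
      exact hy' ((mem_phi hη).2 ((Order.succ_le_of_lt hlt).trans hβη))
    · intro h
      refine ⟨x α.1, (mem_phi α.2).2 h, fun hmem ↦ ?_⟩
      exact (Order.lt_succ α.1).not_ge ((mem_phi α.2).1 hmem)
  let := fellTopology X
  change IsOpen ((Subtype.val : Set.range φ → CL X) ⁻¹' (φ '' V))
  rw [isOpen_iff_forall_mem_open]
  rintro ⟨_, -⟩ ⟨α, hα, rfl⟩
  have hs : Order.succ α.1 < ω₁ := (Cardinal.isSuccLimit_omega 1).succ_lt α.2
  have hU := isOpen_fellTopology_hit (φ ⟨Order.succ α.1, hs⟩).2.2.isOpen_compl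
  by_cases h0 : α.1 = 0
  · refine ⟨_, ?_, hU.preimage continuous_subtype_val, (hit α α hs).2 le_rfl⟩
    rintro ⟨_, β, rfl⟩ hβ
    have hβα : β = α := le_antisymm ((hit α β hs).1 hβ) (h0.trans_le bot_le)
    exact ⟨β, hβα ▸ hα, rfl⟩
  · obtain ⟨W, hW, rfl⟩ := isOpen_induced_iff.1 hV
    obtain ⟨γ, hγα, hγW⟩ := exists_Ioc_subset_of_mem_nhds (hW.mem_nhds hα)
      ⟨0, pos_iff_ne_zero.2 h0⟩
    have hγ : γ < ω₁ := hγα.trans α.2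
    have miss (β : {o : Ordinal // o < ω₁}) : (φ β).1 ⊆ {x γ}ᶜ ↔ γ < β.1 := by
      rw [Set.subset_compl_singleton_iff, mem_phi hγ, not_le]
    refine ⟨_, ?_, (hU.inter (isOpen_fellTopology_miss (isCompact_singleton (x := x γ)))).preimage
      continuous_subtype_val, (hit α α hs).2 le_rfl, (miss α).2 hγα⟩
    rintro ⟨_, β, rfl⟩ ⟨hβ, hβ'⟩
    exact ⟨β, hγW ⟨(miss β).1 hβ', (hit α β hs).1 hβ⟩, rfl⟩
end
end

section
/- Let X be a Hausdorff topological space, and let x : ω₁ → X and y : ω₁ → X be injective maps with disjoint ranges D₀ = {x_α : α < ω₁} and D₁ = {y_α : α < ω₁} such that D₀ ∪ D₁ is a closed discrete subset of X. Define E₀ = X, E_α = {x_β : α ≤ β < ω₁} for 0 < α < ω₁, F₀ = X, F_α = {y_β : α ≤ β < ω₁} ∪ {y₀} for 0 < α < ω₁, and F_{ω₁} = {y₀}. Define Π : ω₁ × (ω₁ + 1) → CL(X) by Π(0,0) = X, Π(0,β) = F_β for 0 < β ≤ ω₁, Π(α,0) = E_α for 0 < α < ω₁, and Π(α,β) = E_α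 ∪ F_β for 0 < α < ω₁ and 0 < β ≤ ω₁. Then the image 𝓛 = Π(ω₁ × (ω₁ + 1)) is a closed subset of (CL(X), τ_F). -/
open Set Topology Ordinal

noncomputable section

/-- Every closure point `A` of a set `S` in the Fell topology is approximated by members of `S`
meeting a prescribed open set that meets `A` and missing a prescribed compact set that misses `A`. -/
lemma exists_mem_of_mem_closure_fell {X : Type*} [TopologicalSpace X] {S : Set (CL X)} {A : CL X}
    (hA : A ∈ @closure _ (fellTopology X) S) {U K : Set X} (hU : IsOpen U) (hK : IsCompact K)
    (hAU : (A.1 ∩ U).Nonempty) (hAK : A.1 ⊆ Kᶜ) :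
    ∃ B ∈ S, (B.1 ∩ U).Nonempty ∧ B.1 ⊆ Kᶜ := by
  let := fellTopology X
  have h₁ : IsOpen {B : CL X | (B.1 ∩ U).Nonempty} :=
    TopologicalSpace.isOpen_generateFrom_of_mem (Or.inl ⟨U, hU, rfl⟩)
  have h₂ : IsOpen {B : CL X | B.1 ⊆ Kᶜ} :=
    TopologicalSpace.isOpen_generateFrom_of_mem (Or.inr ⟨K, hK, rfl⟩)
  obtain ⟨B, hB, hBS⟩ := mem_closure_iff.1 hA _ (h₁.inter h₂) ⟨hAU, hAK⟩
  exact ⟨B, hBS, hB⟩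

/-- An upward closed subset of an initial segment of the ordinals is a final segment of it. -/
lemma exists_eq_Ico_of_upward_closed {w : Ordinal} {S : Set Ordinal} (hS : S ⊆ Set.Iio w)
    (hup : ∀ γ ∈ S, ∀ δ, γ ≤ δ → δ < w → δ ∈ S) : ∃ α ≤ w, S = Set.Ico α w := by
  rcases S.eq_empty_or_nonempty with rfl | hne
  · exact ⟨w, le_rfl, by simp⟩
  · have hmem := csInf_mem hne
    refine ⟨sInf S, (hS hmem).le, Set.Subset.antisymm ?_ ?_⟩
    · exact fun γ hγ => ⟨csInf_le' hγ, hS hγ⟩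
    · exact fun γ hγ => hup _ hmem γ hγ.1 hγ.2

/-- `IsTailSet w v x y A` says that `A` consists of a final segment of `(x γ)` for `0 < γ < w`,
possibly with `y 0` and, if `y 0 ∈ A`, a final segment of `(y γ)` for `0 < γ < v`. -/
structure IsTailSet {X : Type*} (w v : Ordinal) (x : Ordinal → X) (y : Ordinal → X) (A : Set X) : Prop where
  subset : A ⊆ x '' Set.Iio w ∪ y '' Set.Iio v
  x_zero : x 0 ∉ A
  x_up : ∀ γ δ, γ ≤ δ → δ < w → x γ ∈ A → x δ ∈ A
  y_zero : ∀ γ, γ < v → y γ ∈ A → y 0 ∈ A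
  y_up : ∀ γ δ, γ ≠ 0 → γ ≤ δ → δ < v → y γ ∈ A → y δ ∈ A

section

variable {X : Type*} {w v : Ordinal} {x : Ordinal → X} {y : Ordinal → X}

lemma mem_image_Ico_iff (hx : Set.InjOn x (Set.Iio w)) {α γ : Ordinal} (hγ : γ < w) :
    x γ ∈ x '' Set.Ico α w ↔ α ≤ γ := by
  rw [hx.mem_image_iff (fun _ h => h.2) hγ]
  simp [hγ]

lemma notMem_image_Ico (h : Disjoint (x '' Set.Iio w) (y '' Set.Iio v)) {α : Ordinal} {γ : Ordinal}
    (hγ : γ < v) : y γ ∉ x '' Set.Ico α w := fun hm =>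
  Set.disjoint_left.1 h (Set.image_mono (fun _ h => h.2) hm) ⟨γ, hγ, rfl⟩

lemma isTailSet_image_Ico (hw : 0 < w) (hx : Set.InjOn x (Set.Iio w))
    (h : Disjoint (x '' Set.Iio w) (y '' Set.Iio v)) {α : Ordinal} (hα : α ≠ 0) :
    IsTailSet w v x y (x '' Set.Ico α w) where
  subset := (Set.image_mono fun _ h => h.2).trans Set.subset_union_left
  x_zero := by simpa [mem_image_Ico_iff hx hw] using hα
  x_up γ δ hγδ hδ := by
    rw [mem_image_Ico_iff hx hδ, mem_image_Ico_iff hx (hγδ.trans_lt hδ)]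
    exact fun hαγ => hαγ.trans hγδ
  y_zero γ hγ hm := (notMem_image_Ico h hγ hm).elim
  y_up γ δ _ hγδ hδ hm := (notMem_image_Ico h (hγδ.trans_lt hδ) hm).elim

lemma isTailSet_union (hw : 0 < w) (hv : 0 < v) (hx : Set.InjOn x (Set.Iio w)) (hy : Set.InjOn y (Set.Iio v))
    (h : Disjoint (x '' Set.Iio w) (y '' Set.Iio v)) {α : Ordinal} {β : Ordinal} (hα : α ≠ 0) :
    IsTailSet w v x y (x '' Set.Ico α w ∪ (y '' Set.Ico β v ∪ {y 0})) := by
  have hxm : ∀ γ, γ < w →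
      (x γ ∈ x '' Set.Ico α w ∪ (y '' Set.Ico β v ∪ {y 0}) ↔ α ≤ γ) := by
    intro γ hγ
    have h₀ : x γ ≠ y 0 := fun he => Set.disjoint_left.1 h ⟨γ, hγ, rfl⟩ ⟨0, hv, he.symm⟩
    rw [Set.mem_union, mem_image_Ico_iff hx hγ, Set.mem_union, Set.mem_singleton_iff]
    simp [-Set.mem_image, notMem_image_Ico h.symm hγ, h₀]
  have hym : ∀ γ, γ < v →
      (y γ ∈ x '' Set.Ico α w ∪ (y '' Set.Ico β v ∪ {y 0}) ↔ β ≤ γ ∨ γ = 0) := by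
    intro γ hγ
    have h₀ : y γ = y 0 ↔ γ = 0 := hy.eq_iff hγ hv
    rw [Set.mem_union, Set.mem_union, mem_image_Ico_iff hy hγ, Set.mem_singleton_iff, h₀]
    simp [-Set.mem_image, notMem_image_Ico h hγ]
  refine ⟨?_, ?_, ?_, ?_, ?_⟩
  · rintro a (⟨γ, hγ, rfl⟩ | ⟨γ, hγ, rfl⟩ | rfl)
    · exact Or.inl ⟨γ, hγ.2, rfl⟩
    · exact Or.inr ⟨γ, hγ.2, rfl⟩
    · exact Or.inr ⟨0, hv, rfl⟩
  · rw [hxm 0 hw]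
    simpa using hα
  · intro γ δ hγδ hδ
    rw [hxm δ hδ, hxm γ (hγδ.trans_lt hδ)]
    exact fun hαγ => hαγ.trans hγδ
  · intro γ _ _
    exact (hym 0 hv).2 (Or.inr rfl)
  · intro γ δ hγ hγδ hδ
    rw [hym δ hδ, hym γ (hγδ.trans_lt hδ)]
    rintro (hβγ | rfl)
    · exact Or.inl (hβγ.trans hγδ)
    · exact (hγ rfl).elim

lemma IsTailSet.eq_image_Ico_or_eq_union {A : Set X} (hA : IsTailSet w v x y A) (hw : 0 < w) (hv : 0 < v) :
    (∃ α ≤ w, α ≠ 0 ∧ A = x '' Set.Ico α w) ∨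
      ∃ α ≤ w, ∃ β ≤ v, α ≠ 0 ∧ β ≠ 0 ∧
        A = x '' Set.Ico α w ∪ (y '' Set.Ico β v ∪ {y 0}) := by
  obtain ⟨α, hαw, hα⟩ : ∃ α ≤ w, {γ | γ < w ∧ x γ ∈ A} = Set.Ico α w :=
    exists_eq_Ico_of_upward_closed (fun _ h => h.1)
      fun γ hγ δ hγδ hδ => ⟨hδ, hA.x_up γ δ hγδ hδ hγ.2⟩
  obtain ⟨β, hβv, hβ⟩ : ∃ β ≤ v, {γ | γ < v ∧ γ ≠ 0 ∧ y γ ∈ A} = Set.Ico β v :=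
    exists_eq_Ico_of_upward_closed (fun _ h => h.1)
      fun γ hγ δ hγδ hδ => ⟨hδ, ((pos_iff_ne_zero.2 hγ.2.1).trans_le hγδ).ne',
        hA.y_up γ δ hγ.2.1 hγδ hδ hγ.2.2⟩
  have hα₀ : α ≠ 0 := by
    rintro rfl
    exact hA.x_zero (hα.ge ⟨le_rfl, hw⟩).2
  have hβ₀ : β ≠ 0 := by
    rintro rfl
    exact (hβ.ge ⟨le_rfl, hv⟩).2.1 rfl
  by_cases h₀ : y 0 ∈ A
  · refine Or.inr ⟨α, hαw, β, hβv, hα₀, hβ₀, Set.Subset.antisymm ?_ ?_⟩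
    · intro a ha
      rcases hA.subset ha with ⟨γ, hγ, rfl⟩ | ⟨γ, hγ, rfl⟩
      · exact Or.inl ⟨γ, hα.le ⟨hγ, ha⟩, rfl⟩
      · rcases eq_or_ne γ 0 with rfl | hne
        · exact Or.inr (Or.inr rfl)
        · exact Or.inr (Or.inl ⟨γ, hβ.le ⟨hγ, hne, ha⟩, rfl⟩)
    · rintro a (⟨γ, hγ, rfl⟩ | ⟨γ, hγ, rfl⟩ | rfl)
      · exact (hα.ge hγ).2
      · exact (hβ.ge hγ).2.2
      · exact h₀
  · refine Or.inl ⟨α, hαw, hα₀, Set.Subset.antisymm ?_ ?_⟩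
    · intro a ha
      rcases hA.subset ha with ⟨γ, hγ, rfl⟩ | ⟨γ, hγ, rfl⟩
      · exact ⟨γ, hα.le ⟨hγ, ha⟩, rfl⟩
      · exact (h₀ (hA.y_zero γ hγ ha)).elim
    · rintro a ⟨γ, hγ, rfl⟩
      exact (hα.ge hγ).2

/-- If every member of `S` other than the whole space is a tail set, then so is every closure
point of `S` in the Fell topology other than the whole space. -/
lemma isTailSet_of_mem_closure_fell [TopologicalSpace X] (hw : 0 < w)
    (hD_closed : IsClosed (x '' Set.Iio w ∪ y '' Set.Iio v))
    (hD_disc : DiscreteTopology ↥(x '' Set.Iio w ∪ y '' Set.Iio v)) {S : Set (CL X)}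
    (hS : ∀ B ∈ S, B.1 ≠ Set.univ → IsTailSet w v x y B.1) {A : CL X}
    (hA : A ∈ @closure _ (fellTopology X) S) (hA_univ : A.1 ≠ Set.univ) :
    IsTailSet w v x y A.1 := by
  obtain ⟨b, hb⟩ := (Set.ne_univ_iff_exists_notMem _).1 hA_univ
  have approx : ∀ p ∈ x '' Set.Iio w ∪ y '' Set.Iio v, p ∈ A.1 → ∀ q ∉ A.1,
      ∃ B : Set X, IsTailSet w v x y B ∧ p ∈ B ∧ q ∉ B := by
    intro p hpD hp q hq
    obtain ⟨U, hU, hUD⟩ := discreteTopology_subtype_iff'.1 hD_disc p hpD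
    obtain ⟨B, hBS, ⟨c, hcB, hcU⟩, hBK⟩ := exists_mem_of_mem_closure_fell hA hU
      (isCompact_singleton.union isCompact_singleton : IsCompact ({q} ∪ {b}))
      ⟨p, hp, (hUD.ge rfl).1⟩ (by
        rintro a ha (rfl | rfl)
        · exact hq ha
        · exact hb ha)
    have hB := hS B hBS fun h => hBK (h.ge (Set.mem_univ b)) (Or.inr rfl)
    obtain rfl : c = p := hUD.le ⟨hcU, hB.subset hcB⟩
    exact ⟨B.1, hB, hcB, fun hqB => hBK hqB (Or.inl rfl)⟩
  refine ⟨?_, ?_, ?_, ?_, ?_⟩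
  · intro a ha
    by_contra haD
    obtain ⟨B, hBS, ⟨c, hcB, hcU⟩, hBK⟩ := exists_mem_of_mem_closure_fell hA
      hD_closed.isOpen_compl (isCompact_singleton (x := b)) ⟨a, ha, haD⟩ (by
        rintro a ha rfl
        exact hb ha)
    exact hcU ((hS B hBS fun h => hBK (h.ge (Set.mem_univ b)) rfl).subset hcB)
  · intro h
    obtain ⟨B, hB, hpB, -⟩ := approx _ (Or.inl ⟨0, hw, rfl⟩) h b hb
    exact hB.x_zero hpB
  · intro γ δ hγδ hδ h
    by_contra hn
    obtain ⟨B, hB, hpB, hqB⟩ := approx _ (Or.inl ⟨γ, hγδ.trans_lt hδ, rfl⟩) h _ hn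
    exact hqB (hB.x_up γ δ hγδ hδ hpB)
  · intro γ hγ h
    by_contra hn
    obtain ⟨B, hB, hpB, hqB⟩ := approx _ (Or.inr ⟨γ, hγ, rfl⟩) h _ hn
    exact hqB (hB.y_zero γ hγ hpB)
  · intro γ δ hγ hγδ hδ h
    by_contra hn
    obtain ⟨B, hB, hpB, hqB⟩ := approx _ (Or.inr ⟨γ, hγδ.trans_lt hδ, rfl⟩) h _ hn
    exact hqB (hB.y_up γ δ hγ hγδ hδ hpB)

end

/-- Let `x, y : ω₁ → X` be injective with disjoint ranges `D₀`, `D₁` such that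
`D₀ ∪ D₁` is closed and discrete. With `E₀ = F₀ = X`,
`E_α = {x_β : α ≤ β < ω₁}`, `F_β = {y_γ : β ≤ γ < ω₁} ∪ {y₀}` (`0 < α, β < ω₁`)
and `F_{ω₁} = {y₀}`, define `Π(α,β)` as `X`, `F_β`, `E_α`, or `E_α ∪ F_β` according
to whether `α`, `β` vanish. Then the image `𝓛 = Π(ω₁ × (ω₁ + 1))` is a closed subset
of `(CL X, τ_F)`. -/
theorem range_Pi_isClosed_fell {X : Type*} [TopologicalSpace X] [T2Space X]
    (x y : Ordinal → X)
    (hx_inj : Set.InjOn x (Set.Iio ω₁)) (hy_inj : Set.InjOn y (Set.Iio ω₁))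
    (h_disj : Disjoint (x '' Set.Iio ω₁) (y '' Set.Iio ω₁))
    (hD_closed : IsClosed (x '' Set.Iio ω₁ ∪ y '' Set.Iio ω₁))
    (hD_disc : DiscreteTopology ↥(x '' Set.Iio ω₁ ∪ y '' Set.Iio ω₁))
    (Pmap : {o : Ordinal // o < ω₁} × {o : Ordinal // o ≤ ω₁} → CL X)
    (hP_00 : ∀ p : {o : Ordinal // o < ω₁} × {o : Ordinal // o ≤ ω₁},
      p.1.1 = 0 → p.2.1 = 0 → (Pmap p).1 = Set.univ)
    (hP_0mid : ∀ p : {o : Ordinal // o < ω₁} × {o : Ordinal // o ≤ ω₁},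
      p.1.1 = 0 → p.2.1 ≠ 0 → p.2.1 < ω₁ →
      (Pmap p).1 = y '' Set.Ico p.2.1 ω₁ ∪ {y 0})
    (hP_0top : ∀ p : {o : Ordinal // o < ω₁} × {o : Ordinal // o ≤ ω₁},
      p.1.1 = 0 → p.2.1 = ω₁ → (Pmap p).1 = {y 0})
    (hP_pos0 : ∀ p : {o : Ordinal // o < ω₁} × {o : Ordinal // o ≤ ω₁},
      p.1.1 ≠ 0 → p.2.1 = 0 → (Pmap p).1 = x '' Set.Ico p.1.1 ω₁)
    (hP_posmid : ∀ p : {o : Ordinal // o < ω₁} × {o : Ordinal // o ≤ ω₁},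
      p.1.1 ≠ 0 → p.2.1 ≠ 0 → p.2.1 < ω₁ →
      (Pmap p).1 = x '' Set.Ico p.1.1 ω₁ ∪ (y '' Set.Ico p.2.1 ω₁ ∪ {y 0}))
    (hP_postop : ∀ p : {o : Ordinal // o < ω₁} × {o : Ordinal // o ≤ ω₁},
      p.1.1 ≠ 0 → p.2.1 = ω₁ → (Pmap p).1 = x '' Set.Ico p.1.1 ω₁ ∪ {y 0}) :
    @IsClosed _ (fellTopology X) (Set.range Pmap) := by
  have hw : (0 : Ordinal.{u_2}) < ω₁ := omega_pos 1
  have hv : (0 : Ordinal.{u_3}) < ω₁ := omega_pos 1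
  have hP_zero : ∀ p : {o : Ordinal // o < ω₁} × {o : Ordinal // o ≤ ω₁},
      p.1.1 = 0 → p.2.1 ≠ 0 →
      (Pmap p).1 = x '' Set.Ico ω₁ ω₁ ∪ (y '' Set.Ico p.2.1 ω₁ ∪ {y 0}) := by
    intro p h₁ h₂
    rcases p.2.2.lt_or_eq with h | h
    · simp [hP_0mid p h₁ h₂ h]
    · simp [hP_0top p h₁ h, h]
  have hP_pos : ∀ p : {o : Ordinal // o < ω₁} × {o : Ordinal // o ≤ ω₁},
      p.1.1 ≠ 0 → p.2.1 ≠ 0 →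
      (Pmap p).1 = x '' Set.Ico p.1.1 ω₁ ∪ (y '' Set.Ico p.2.1 ω₁ ∪ {y 0}) := by
    intro p h₁ h₂
    rcases p.2.2.lt_or_eq with h | h
    · exact hP_posmid p h₁ h₂ h
    · simp [hP_postop p h₁ h, h]
  have htail : ∀ B ∈ Set.range Pmap, B.1 ≠ Set.univ → IsTailSet ω₁ ω₁ x y B.1 := by
    rintro _ ⟨p, rfl⟩ hne
    by_cases h₁ : p.1.1 = 0 <;> by_cases h₂ : p.2.1 = 0
    · exact (hne (hP_00 p h₁ h₂)).elim
    · rw [hP_zero p h₁ h₂]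
      exact isTailSet_union hw hv hx_inj hy_inj h_disj hw.ne'
    · rw [hP_pos0 p h₁ h₂]
      exact isTailSet_image_Ico hw hx_inj h_disj h₁
    · rw [hP_pos p h₁ h₂]
      exact isTailSet_union hw hv hx_inj hy_inj h_disj h₁
  let := fellTopology X
  refine isClosed_of_closure_subset fun A hA => ?_
  by_cases hA_univ : A.1 = Set.univ
  · exact ⟨(⟨0, hw⟩, ⟨0, hv.le⟩), Subtype.ext ((hP_00 _ rfl rfl).trans hA_univ.symm)⟩
  rcases (isTailSet_of_mem_closure_fell hw hD_closed hD_disc htail hA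
    hA_univ).eq_image_Ico_or_eq_union hw hv with
    ⟨α, hαw, hα, hAeq⟩ | ⟨α, hαw, β, hβv, hα, hβ, hAeq⟩
  · rcases hαw.lt_or_eq with hαw | rfl
    · exact ⟨(⟨α, hαw⟩, ⟨0, hv.le⟩), Subtype.ext ((hP_pos0 _ hα rfl).trans hAeq.symm)⟩
    · exact (A.2.1.ne_empty (by simpa using hAeq)).elim
  · rcases hαw.lt_or_eq with hαw | rfl
    · exact ⟨(⟨α, hαw⟩, ⟨β, hβv⟩), Subtype.ext ((hP_pos _ hα hβ).trans hAeq.symm)⟩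
    · exact ⟨(⟨0, hw⟩, ⟨β, hβv⟩), Subtype.ext ((hP_zero _ rfl hβ).trans hAeq.symm)⟩
end
end

section
/- Let (X,d) be a metric space with nice closed balls, i.e., every closed ball in X that is a proper subset of X is compact. If the hyperspace (CL(X), τ_{w(d)}) with the Wijsman topology is not a normal topological space, then (CL(X), τ_{w(d)}) contains a closed copy of ω₁ × (ω₁ + 1); that is, there is a closed embedding of the product space ω₁ × (ω₁ + 1) into (CL(X), τ_{w(d)}). -/
open Set Topology Ordinal

noncomputable section

/-- The Wijsman topology on `CL X` for a metric space `(X, d)`: the weakest topology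
making each distance functional `A ↦ d(x, A)` continuous. -/
def wijsmanTopology (X : Type*) [MetricSpace X] : TopologicalSpace (CL X) :=
  ⨅ x : X, TopologicalSpace.induced (fun A : CL X => Metric.infDist x A.1) inferInstance

namespace Wijsman

attribute [local instance] wijsmanTopology

theorem continuous_infDist {X : Type*} [MetricSpace X] (x : X) :
    Continuous fun A : CL X => Metric.infDist x A.1 :=
  continuous_iff_le_induced.2 (iInf_le _ x)

theorem continuous_iff {X P : Type*} [MetricSpace X] [TopologicalSpace P] {f : P → CL X} :
    Continuous f ↔ ∀ x, Continuous fun p => Metric.infDist x (f p).1 := by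
  refine ⟨fun h x => (continuous_infDist x).comp h, fun h => ?_⟩
  exact continuous_iInf_rng.2 fun x => continuous_induced_rng.2 (h x)

instance t2Space (X : Type*) [MetricSpace X] : T2Space (CL X) := by
  refine T2Space.of_injective_continuous
    (f := fun (A : CL X) (x : X) => Metric.infDist x A.1) ?_
    (continuous_pi continuous_infDist)
  intro A B h
  apply Subtype.ext
  ext x
  rw [A.2.2.mem_iff_infDist_zero A.2.1, B.2.2.mem_iff_infDist_zero B.2.1]
  exact iff_of_eq (congrArg (· = 0) (congrFun h x))

/-- The hyperspace of a separable space is normal, because its topology is induced by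
countably many distance functionals. -/
theorem normalSpace_of_separableSpace (X : Type*) [MetricSpace X]
    [TopologicalSpace.SeparableSpace X] : NormalSpace (CL X) := by
  obtain ⟨s, hs, hd⟩ := TopologicalSpace.exists_countable_dense X
  have : Countable s := hs.to_subtype
  let F : CL X → s → ℝ := fun A x => Metric.infDist x.1 A.1
  have hF : IsInducing F := by
    refine ⟨le_antisymm ?_ ?_⟩
    · exact continuous_iff_le_induced.1 (continuous_pi fun x => continuous_infDist x.1)
    · refine le_iInf fun x => ?_
      rw [← continuous_iff_le_induced]
      let _ : TopologicalSpace (CL X) := TopologicalSpace.induced F inferInstance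
      refine continuous_of_uniform_approx_of_continuous fun u hu => ?_
      obtain ⟨ε, hε, hu⟩ := Metric.mem_uniformity_dist.1 hu
      obtain ⟨y, hy, hxy⟩ := hd.exists_dist_lt x hε
      have hFc : Continuous F := continuous_induced_dom
      refine ⟨fun A => Metric.infDist y A.1, (continuous_apply (⟨y, hy⟩ : s)).comp hFc, ?_⟩
      intro A
      apply hu
      refine lt_of_le_of_lt ?_ hxy
      simpa using (Metric.lipschitz_infDist_pt A.1).dist_le_mul x y
  have := hF.pseudoMetrizableSpace
  infer_instance

/-- A nonseparable metric space contains an uncountable uniformly separated set. -/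
theorem exists_uncountable_separated (X : Type*) [MetricSpace X]
    (h : ¬ TopologicalSpace.SeparableSpace X) :
    ∃ ε > 0, ∃ s : Set X, ¬ s.Countable ∧ s.Pairwise fun x y => ε ≤ dist x y := by
  contrapose! h
  suffices SecondCountableTopology X from inferInstance
  refine Metric.secondCountable_of_almost_dense_set fun ε hε => ?_
  obtain ⟨s, hs⟩ := zorn_subset {s : Set X | s.Pairwise fun x y => ε ≤ dist x y} fun c hc hch =>
    ⟨⋃₀ c, (pairwise_sUnion hch.directedOn).2 hc, fun t ht => subset_sUnion_of_mem ht⟩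
  refine ⟨s, ?_, fun x => ?_⟩
  · by_contra hcount
    exact h ε hε s hcount hs.prop
  · by_contra! hx
    have hins : (insert x s).Pairwise fun x y => ε ≤ dist x y :=
      hs.prop.insert fun y hy _ => ⟨(hx y hy).le, dist_comm x y ▸ (hx y hy).le⟩
    have hxs : x ∈ s := hs.le_of_ge hins (subset_insert x s) (mem_insert x s)
    have := hx x hxs
    rw [dist_self] at this
    exact this.not_gt hε

section Embedding

variable {X P : Type*} [MetricSpace X] {ε : ℝ} {x : P → X}

theorem injective_of_separated (hε : 0 < ε) (hx : Pairwise fun p q => ε ≤ dist (x p) (x q)) :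
    Function.Injective x := by
  intro p q h
  by_contra hpq
  have : ε ≤ dist (x p) (x q) := hx hpq
  rw [h, dist_self] at this
  exact this.not_gt hε

theorem finite_preimage_of_isCompact (hε : 0 < ε)
    (hx : Pairwise fun p q => ε ≤ dist (x p) (x q)) {K : Set X} (hK : IsCompact K) :
    (x ⁻¹' K).Finite := by
  obtain ⟨t, -, ht, hKt⟩ := hK.finite_cover_balls (half_pos hε)
  have : ∀ p, ∃ c, p ∈ x ⁻¹' K → c ∈ t ∧ x p ∈ Metric.ball c (ε / 2) := fun p => by
    by_cases hp : p ∈ x ⁻¹' K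
    · obtain ⟨c, hct, hc⟩ := mem_iUnion₂.1 (hKt hp)
      exact ⟨c, fun _ => ⟨hct, hc⟩⟩
    · exact ⟨x p, fun h => (hp h).elim⟩
  choose c hc using this
  refine Finite.of_finite_image (ht.subset (image_subset_iff.2 fun p hp => (hc p hp).1)) fun p hp q hq hpq => ?_
  by_contra hne
  have h₁ := (hc p hp).2
  have h₂ := (hc q hq).2
  simp only [Metric.mem_ball] at h₁ h₂
  rw [hpq] at h₁
  linarith [hx hne, dist_triangle_right (x p) (x q) (c q)]

variable [PartialOrder P]

/-- The closed set of all values of a uniformly separated family at indices above `p`. -/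
def tail (hε : 0 < ε) (hx : Pairwise fun p q => ε ≤ dist (x p) (x q)) (p : P) : CL X :=
  ⟨x '' Ici p, nonempty_Ici.image x, Metric.isClosed_of_pairwise_le_dist hε (by
    rintro _ ⟨q, -, rfl⟩ _ ⟨r, -, rfl⟩ hqr
    exact hx fun h => hqr (h ▸ rfl))⟩

theorem tail_injective (hε : 0 < ε) (hx : Pairwise fun p q => ε ≤ dist (x p) (x q)) :
    Function.Injective (tail hε hx) := fun _ _ h =>
  Ici_injective ((injective_of_separated hε hx).image_injective (congrArg Subtype.val h))

variable [TopologicalSpace P]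

theorem continuous_tail (h_balls : ∀ (y : X) (r : ℝ), Metric.closedBall y r ≠ Set.univ →
      IsCompact (Metric.closedBall y r)) (hP : ∀ q : P, IsClopen (Iic q)) (hε : 0 < ε)
    (hx : Pairwise fun p q => ε ≤ dist (x p) (x q)) : Continuous (tail hε hx) := by
  refine continuous_iff.2 fun y => continuous_iff_continuousAt.2 fun p => ?_
  refine tendsto_order.2 ⟨fun r hr => ?_, fun r hr => ?_⟩
  · obtain ⟨r', hrr', hr'⟩ := exists_between hr
    have hmiss : ∀ q, p ≤ q → x q ∉ Metric.closedBall y r' := fun q hq hmem => by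
      have := Metric.infDist_le_dist_of_mem (x := y)
        (show x q ∈ (tail hε hx p).1 from ⟨q, hq, rfl⟩)
      rw [Metric.mem_closedBall'] at hmem
      linarith
    have hfin := finite_preimage_of_isCompact hε hx (h_balls y r' fun h =>
      hmiss p le_rfl (h ▸ mem_univ _))
    have hev : ∀ᶠ p' in 𝓝 p, ∀ q ∈ x ⁻¹' Metric.closedBall y r', p' ∈ (Iic q)ᶜ :=
      (hfin.eventually_all).2 fun q hq =>
        (hP q).compl.isOpen.mem_nhds fun hpq => hmiss q hpq hq
    filter_upwards [hev] with p' hp'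
    refine hrr'.trans_le ((Metric.le_infDist (tail hε hx p').2.1).2 ?_)
    rintro _ ⟨q, hq, rfl⟩
    by_contra! hlt
    exact hp' q (Metric.mem_closedBall'.2 hlt.le) hq
  · obtain ⟨_, ⟨q, hq, rfl⟩, hlt⟩ := (Metric.infDist_lt_iff (tail hε hx p).2.1).1 hr
    filter_upwards [(hP q).isOpen.mem_nhds hq] with p' hp'
    exact (Metric.infDist_lt_iff (tail hε hx p').2.1).2 ⟨x q, ⟨q, hp', rfl⟩, hlt⟩

theorem isClosedEmbedding_tail
    (h_balls : ∀ (y : X) (r : ℝ), Metric.closedBall y r ≠ Set.univ →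
      IsCompact (Metric.closedBall y r))
    (hP : ∀ q : P, IsClopen (Iic q)) (hPc : ∀ q : P, IsCompact (Iic q)) (hε : 0 < ε)
    (hx : Pairwise fun p q => ε ≤ dist (x p) (x q)) : IsClosedEmbedding (tail hε hx) := by
  have hcont := continuous_tail h_balls hP hε hx
  suffices IsProperMap (tail hε hx) from
    .of_continuous_injective_isClosedMap hcont (tail_injective hε hx) this.isClosedMap
  refine isProperMap_iff_ultrafilter.2 ⟨hcont, fun U A hU => ?_⟩
  obtain ⟨a, ha⟩ := A.2.1
  have hev : ∀ᶠ p in (U : Filter P), Metric.infDist a (tail hε hx p).1 < ε / 2 :=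
    ((continuous_infDist a).continuousAt.tendsto.comp hU).eventually_lt_const
      (by rw [Metric.infDist_zero_of_mem ha]; exact half_pos hε)
  have hnear : ∀ᶠ p in (U : Filter P), ∃ q, p ≤ q ∧ dist a (x q) < ε / 2 := by
    filter_upwards [hev] with p hp
    obtain ⟨_, ⟨q, hq, rfl⟩, hlt⟩ := (Metric.infDist_lt_iff (tail hε hx p).2.1).1 hp
    exact ⟨q, hq, hlt⟩
  obtain ⟨-, q₀, -, hq₀⟩ := hnear.exists
  have hle : Iic q₀ ∈ (U : Filter P) := by
    filter_upwards [hnear] with p ⟨q, hpq, hq⟩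
    suffices q = q₀ from this ▸ hpq
    by_contra hne
    linarith [hx hne, dist_triangle_left (x q) (x q₀) a]
  obtain ⟨p, -, hp⟩ := (hPc q₀).ultrafilter_le_nhds' U hle
  exact ⟨p, tendsto_nhds_unique ((hcont.tendsto p).mono_left hp) hU, hp⟩

end Embedding

end Wijsman

namespace Ordinal

theorem isClopen_Iic (a : Ordinal) : IsClopen (Iic a) :=
  ⟨isClosed_Iic, Order.Iio_succ a ▸ isOpen_Iio⟩

theorem isCompact_Iic (a : Ordinal) : IsCompact (Iic a) := by
  rw [← Icc_bot]
  exact isCompact_Icc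

theorem mk_Iio_omega_one : Cardinal.mk {o : Ordinal // o < ω₁} = Cardinal.aleph 1 :=
  (Cardinal.mk_Iio_ordinal ω₁).trans (by simp)

theorem mk_Iic_omega_one : Cardinal.mk {o : Ordinal // o ≤ ω₁} = Cardinal.aleph 1 := by
  have h := Cardinal.mk_Iio_ordinal (Order.succ ω₁)
  rw [Order.Iio_succ] at h
  exact h.trans (by simp [Cardinal.add_one_eq (Cardinal.aleph0_le_aleph 1)])

theorem nonempty_omega_one_prod_embedding {X : Type*} {s : Set X} (hs : ¬ s.Countable) :
    Nonempty ({o : Ordinal // o < ω₁} × {o : Ordinal // o ≤ ω₁} ↪ s) := by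
  have : Cardinal.aleph0 < Cardinal.mk s := by
    rw [← not_le, Cardinal.mk_le_aleph0_iff]
    exact hs
  rw [← Cardinal.lift_mk_le', Cardinal.mk_prod, mk_Iio_omega_one, mk_Iic_omega_one]
  simpa [Cardinal.mul_eq_self (Cardinal.aleph0_le_aleph 1)] using this

end Ordinal

/-- If `(X, d)` is a metric space with nice closed balls (every closed ball that is a
proper subset of `X` is compact) and `(CL X, τ_{w(d)})` is not normal, then
`(CL X, τ_{w(d)})` contains a closed copy of `ω₁ × (ω₁ + 1)`. -/
theorem wijsman_nonNormal_closedEmbedding {X : Type*} [MetricSpace X]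
    (h_balls : ∀ (x : X) (r : ℝ), Metric.closedBall x r ≠ Set.univ →
      IsCompact (Metric.closedBall x r))
    (h_nonnormal : ¬ @NormalSpace (CL X) (wijsmanTopology X)) :
    ∃ f : {o : Ordinal // o < ω₁} × {o : Ordinal // o ≤ ω₁} → CL X,
      @IsClosedEmbedding _ _ _ (wijsmanTopology X) f := by
  have hsep : ¬ TopologicalSpace.SeparableSpace X := fun _ =>
    h_nonnormal (Wijsman.normalSpace_of_separableSpace X)
  obtain ⟨ε, hε, s, hs, hsε⟩ := Wijsman.exists_uncountable_separated X hsep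
  obtain ⟨e⟩ := Ordinal.nonempty_omega_one_prod_embedding hs
  have hx : Pairwise fun p q => ε ≤ dist (e p : X) (e q : X) := fun p q hpq =>
    hsε (e p).2 (e q).2 fun h => hpq (e.injective (Subtype.ext h))
  refine ⟨Wijsman.tail hε hx, Wijsman.isClosedEmbedding_tail h_balls ?_ ?_ hε hx⟩
  · rintro ⟨a, b⟩
    rw [← Iic_prod_Iic]
    exact ((Ordinal.isClopen_Iic a.1).preimage continuous_subtype_val).prod
      ((Ordinal.isClopen_Iic b.1).preimage continuous_subtype_val)
  · rintro ⟨a, b⟩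
    rw [← Iic_prod_Iic]
    refine IsCompact.prod ?_ ?_
    · refine IsInducing.subtypeVal.isCompact_preimage' (Ordinal.isCompact_Iic a.1) ?_
      exact fun o ho => ⟨⟨o, lt_of_le_of_lt ho a.2⟩, rfl⟩
    · refine IsInducing.subtypeVal.isCompact_preimage' (Ordinal.isCompact_Iic b.1) ?_
      exact fun o ho => ⟨⟨o, le_trans ho b.2⟩, rfl⟩
end
end

section
/- Let (X,d) be a metric space such that every closed ball in X that is a proper subset of X is totally bounded. If (X,d) is not separable, then the hyperspace (CL(X), τ_{w(d)}) with the Wijsman topology contains a closed copy of ω₁ × (ω₁ + 1); that is, there is a closed embedding of the product space ω₁ × (ω₁ + 1) into (CL(X), τ_{w(d)}). -/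
open Set Topology Ordinal

noncomputable section

open Filter Function

section Wijsman

variable {X : Type*} [MetricSpace X]

lemma continuous_wijsman_iff {P : Type*} [TopologicalSpace P] {f : P → CL X} :
    @Continuous _ _ _ (wijsmanTopology X) f ↔
      ∀ a : X, Continuous fun p => Metric.infDist a (f p).1 :=
  continuous_iInf_rng.trans (forall_congr' fun _ => continuous_induced_rng)

lemma continuous_infDist_wijsman (a : X) :
    @Continuous _ _ (wijsmanTopology X) _ fun A : CL X => Metric.infDist a A.1 :=
  continuous_iInf_dom continuous_induced_dom

lemma t2Space_wijsman : @T2Space (CL X) (wijsmanTopology X) := by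
  let _ := wijsmanTopology X
  refine T2Space.of_injective_continuous
    (f := fun (A : CL X) (a : X) => Metric.infDist a A.1) (fun A B h => ?_)
    (continuous_pi continuous_infDist_wijsman)
  refine Subtype.ext (Set.ext fun a => ?_)
  have ha : Metric.infDist a A.1 = Metric.infDist a B.1 := congrFun h a
  exact (A.2.2.mem_iff_infDist_zero A.2.1).trans
    ((iff_of_eq (congrArg (· = 0) ha)).trans (B.2.2.mem_iff_infDist_zero B.2.1).symm)

end Wijsman

lemma TotallyBounded.finite_preimage_of_pairwise_le_dist {ι X : Type*} [PseudoMetricSpace X]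
    {s : Set X} (hs : TotallyBounded s) {x : ι → X} {δ : ℝ} (hδ : 0 < δ)
    (hx : Pairwise fun i j => δ ≤ dist (x i) (x j)) : (x ⁻¹' s).Finite := by
  obtain ⟨t, ht, hst⟩ := Metric.totallyBounded_iff.1 hs (δ / 2) (half_pos hδ)
  refine Set.Finite.subset (ht.biUnion fun y _ =>
    Set.Subsingleton.finite (s := {i | dist (x i) y < δ / 2}) fun i hi j hj => ?_)
    fun i hi => by simpa using hst hi
  by_contra hij
  have := hx hij
  have := dist_triangle_right (x i) (x j) y
  simp only [mem_ofPred_eq] at hi hj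
  linarith

lemma exists_uncountable_pairwise_le_dist {X : Type*} [PseudoMetricSpace X]
    (h : ¬ TopologicalSpace.SeparableSpace X) :
    ∃ δ > 0, ∃ D : Set X, ¬ D.Countable ∧ D.Pairwise fun a b => δ ≤ dist a b := by
  contrapose! h
  suffices SecondCountableTopology X from inferInstance
  refine Metric.secondCountable_of_almost_dense_set fun ε hε => ?_
  obtain ⟨D, hD⟩ := zorn_subset {D : Set X | D.Pairwise fun a b => ε ≤ dist a b}
    fun c hc hchain => ⟨⋃₀ c, (pairwise_sUnion hchain.directedOn).2 hc,
      fun s hs => subset_sUnion_of_mem hs⟩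
  refine ⟨D, not_not.1 fun hcount => h ε hε D hcount hD.prop, fun a => ?_⟩
  by_contra! hfar
  have hins : (insert a D).Pairwise fun a b => ε ≤ dist a b :=
    hD.prop.insert fun b hb _ => ⟨(hfar b hb).le, by rw [dist_comm]; exact (hfar b hb).le⟩
  have := hfar a (hD.le_of_ge hins (subset_insert a D) (mem_insert a D))
  rw [dist_self] at this
  linarith

section UpperSets

variable {X P : Type*} [MetricSpace X] [PartialOrder P] [TopologicalSpace P]

/-- If principal lower sets of `P` are clopen, then the distance from a point to the image of a
principal upper set under a uniformly separated family depends continuously on its generator. -/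
lemma continuous_infDist_image_Ici
    (h_balls : ∀ (a : X) (r : ℝ), Metric.closedBall a r ≠ Set.univ →
      TotallyBounded (Metric.closedBall a r))
    (h_clopen : ∀ q : P, IsClopen (Iic q)) {x : P → X} {δ : ℝ} (hδ : 0 < δ)
    (hx : Pairwise fun p q => δ ≤ dist (x p) (x q)) (a : X) :
    Continuous fun p => Metric.infDist a (x '' Ici p) := by
  have h_lt (t : ℝ) : {p | Metric.infDist a (x '' Ici p) < t} =
      ⋃ q ∈ {q | dist a (x q) < t}, Iic q := by
    ext p
    simp [Metric.infDist_lt_iff (nonempty_Ici.image x), and_comm]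
  refine continuous_iff_lower_upperSemicontinuous.2
    ⟨lowerSemicontinuous_iff_isOpen_preimage.2 fun t => ?_,
      upperSemicontinuous_iff_isOpen_preimage.2 fun t => ?_⟩
  · refine isOpen_iff_mem_nhds.2 fun p (hp : t < Metric.infDist a (x '' Ici p)) => ?_
    obtain ⟨s, hts, hsp⟩ := exists_between hp
    have hball : Metric.closedBall a s ≠ Set.univ := fun h => by
      have := Metric.infDist_le_dist_of_mem (x := a) (mem_image_of_mem x (self_mem_Ici (a := p)))
      have : x p ∈ Metric.closedBall a s := h ▸ mem_univ _
      rw [Metric.mem_closedBall, dist_comm] at this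
      linarith
    have hfin : {q | dist a (x q) < s}.Finite :=
      ((h_balls a s hball).finite_preimage_of_pairwise_le_dist hδ hx).subset fun q hq => by
        rw [mem_preimage, Metric.mem_closedBall, dist_comm]
        exact le_of_lt hq
    have hclosed : IsClosed {p | Metric.infDist a (x '' Ici p) < s} := by
      rw [h_lt]
      exact hfin.isClosed_biUnion fun q _ => (h_clopen q).isClosed
    filter_upwards [hclosed.isOpen_compl.mem_nhds (show p ∉ _ from not_lt.2 hsp.le)] with q hq
    exact hts.trans_le (not_lt.1 hq)
  · change IsOpen {p | Metric.infDist a (x '' Ici p) < t}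
    rw [h_lt]
    exact isOpen_biUnion fun q _ => (h_clopen q).isOpen

/-- If principal lower sets of `P` are compact and clopen, then the images of principal upper sets
under a uniformly separated family form a closed copy of `P` in the hyperspace. -/
lemma exists_isClosedEmbedding_wijsman
    (h_balls : ∀ (a : X) (r : ℝ), Metric.closedBall a r ≠ Set.univ →
      TotallyBounded (Metric.closedBall a r))
    (h_clopen : ∀ q : P, IsClopen (Iic q)) (h_compact : ∀ q : P, IsCompact (Iic q))
    {x : P → X} {δ : ℝ} (hδ : 0 < δ) (hx : Pairwise fun p q => δ ≤ dist (x p) (x q)) :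
    ∃ f : P → CL X, @IsClosedEmbedding _ _ _ (wijsmanTopology X) f := by
  let _ := wijsmanTopology X
  have : T2Space (CL X) := t2Space_wijsman
  have h_inj : Injective x := fun p q h => by
    by_contra hne
    have : δ ≤ dist (x p) (x q) := hx hne
    rw [h, dist_self] at this
    linarith
  have h_closed (s : Set P) : IsClosed (x '' s) :=
    Metric.isClosed_of_pairwise_le_dist hδ <| by
      rintro _ ⟨p, -, rfl⟩ _ ⟨q, -, rfl⟩ hpq
      exact hx (ne_of_apply_ne x hpq)
  let f (p : P) : CL X := ⟨x '' Ici p, nonempty_Ici.image x, h_closed _⟩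
  have hf : Continuous f := continuous_wijsman_iff.2
    (continuous_infDist_image_Ici h_balls h_clopen hδ hx)
  have hf_inj : Injective f := fun p q h =>
    Ici_injective (h_inj.image_injective (congrArg Subtype.val h))
  refine ⟨f, .of_continuous_injective_isClosedMap hf hf_inj (IsProperMap.isClosedMap ?_)⟩
  refine isProperMap_iff_ultrafilter_of_t2.2 ⟨hf, fun U A hA => ?_⟩
  obtain ⟨a, ha⟩ := A.2.1
  have h_near : ∀ᶠ p in (U : Filter P), ∃ q, p ≤ q ∧ dist a (x q) < δ / 2 := by
    have := ((continuous_infDist_wijsman a).tendsto A).comp hA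
    rw [Metric.infDist_zero_of_mem ha] at this
    filter_upwards [this.eventually_lt_const (half_pos hδ)] with p hp
    have hp : Metric.infDist a (x '' Ici p) < δ / 2 := hp
    simpa [Metric.infDist_lt_iff (nonempty_Ici.image x)] using hp
  obtain ⟨-, q, -, hq⟩ := h_near.exists
  have h_mem : Iic q ∈ U := by
    filter_upwards [h_near] with p ⟨r, hpr, hr⟩
    suffices r = q from this ▸ hpr
    by_contra hne
    have := hx hne
    have := dist_triangle_left (x r) (x q) a
    linarith
  obtain ⟨p, -, hp⟩ := (h_compact q).ultrafilter_le_nhds U (le_principal_iff.2 h_mem)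
  exact ⟨p, hp⟩

end UpperSets

section Ordinals

lemma Ordinal.isClopen_Iic_s9 (o : Ordinal) : IsClopen (Iic o) :=
  ⟨isClosed_Iic, by rw [← Order.Iio_succ]; exact isOpen_Iio⟩

lemma Ordinal.isCompact_Iic_s9 (o : Ordinal) : IsCompact (Iic o) := by
  rw [← Icc_bot]
  exact isCompact_Icc

lemma Ordinal.isClopen_Iic_subtype {s : Set Ordinal} (o : s) : IsClopen (Iic o) :=
  (Ordinal.isClopen_Iic_s9 o.1).preimage continuous_subtype_val

lemma Ordinal.isCompact_Iic_subtype {s : Set Ordinal} (hs : IsLowerSet s) (o : s) :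
    IsCompact (Iic o) := by
  rw [Subtype.isCompact_iff]
  convert Ordinal.isCompact_Iic_s9 o.1
  ext a
  exact ⟨fun ⟨b, hb, hba⟩ => hba ▸ hb, fun ha => ⟨⟨a, hs ha o.2⟩, ha, rfl⟩⟩

open Cardinal in
lemma nonempty_embedding_of_not_countable.{u, v, w} {X : Type u} {D : Set X} (hD : ¬ D.Countable) :
    Nonempty ({o : Ordinal.{v} // o < ω₁} × {o : Ordinal.{w} // o ≤ ω₁} ↪ D) := by
  have h₁ : #{o : Ordinal.{v} // o < ω₁} = ℵ₁ := by
    have := Cardinal.mk_Iio_ordinal (ω₁ : Ordinal.{v})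
    rwa [Ordinal.card_omega, Cardinal.lift_aleph, Ordinal.lift_one] at this
  have h₂ : #{o : Ordinal.{w} // o ≤ ω₁} = ℵ₁ := by
    have := Cardinal.mk_Iio_ordinal (Order.succ ω₁ : Ordinal.{w})
    have h : (ℵ₁ : Cardinal.{w + 1}) + 1 = ℵ₁ :=
      Cardinal.add_one_eq (Cardinal.aleph0_le_aleph 1)
    rwa [Order.Iio_succ, Order.succ_eq_add_one, Ordinal.card_add, Ordinal.card_one,
      Ordinal.card_omega, Cardinal.lift_add, Cardinal.lift_one, Cardinal.lift_aleph,
      Ordinal.lift_one, h] at this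
  have h₃ : ℵ₁ ≤ #D := by
    rw [← Cardinal.succ_aleph0, Order.succ_le_iff, ← not_le]
    rwa [Cardinal.le_aleph0_iff_set_countable]
  rw [← Cardinal.lift_mk_le', Cardinal.mk_prod, h₁, h₂]
  have h : (ℵ₁ : Cardinal.{max (v + 1) (w + 1)}) * ℵ₁ = ℵ₁ :=
    Cardinal.mul_eq_self (Cardinal.aleph0_le_aleph 1)
  simpa [h] using h₃

end Ordinals

/-- If `(X, d)` is a non-separable metric space in which every closed ball that is a
proper subset of `X` is totally bounded, then `(CL X, τ_{w(d)})` contains a closed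
copy of `ω₁ × (ω₁ + 1)`. -/
theorem wijsman_nonSeparable_closedEmbedding {X : Type*} [MetricSpace X]
    (h_balls : ∀ (x : X) (r : ℝ), Metric.closedBall x r ≠ Set.univ →
      TotallyBounded (Metric.closedBall x r))
    (h_nonsep : ¬ TopologicalSpace.SeparableSpace X) :
    ∃ f : {o : Ordinal // o < ω₁} × {o : Ordinal // o ≤ ω₁} → CL X,
      @IsClosedEmbedding _ _ _ (wijsmanTopology X) f := by
  obtain ⟨δ, hδ, D, hD, hsep⟩ := exists_uncountable_pairwise_le_dist h_nonsep
  obtain ⟨e⟩ := nonempty_embedding_of_not_countable hD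
  refine exists_isClosedEmbedding_wijsman h_balls (fun q => ?_) (fun q => ?_)
    (x := fun p => (e p : X)) hδ fun p q hpq =>
      hsep (e p).2 (e q).2 (Subtype.coe_injective.ne (e.injective.ne hpq))
  · rw [Iic_prod_eq]
    exact (Ordinal.isClopen_Iic_subtype (s := Iio ω₁) q.1).prod
      (Ordinal.isClopen_Iic_subtype (s := Iic ω₁) q.2)
  · rw [Iic_prod_eq]
    exact (Ordinal.isCompact_Iic_subtype (isLowerSet_Iio ω₁) q.1).prod
      (Ordinal.isCompact_Iic_subtype (isLowerSet_Iic ω₁) q.2)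
end
end

section
/- Let (X,d) be a metric space such that every closed ball in X that is a proper subset of X is totally bounded, let ε > 0, and let x : ω₁ → X be an injective map whose range D = {x_α : α < ω₁} is ε-discrete, i.e., d(x_α, x_β) ≥ ε for all α ≠ β. Define E₀ = X and E_α = {x_η : α ≤ η < ω₁} for 0 < α < ω₁. Then the map φ : ω₁ → CL(X), φ(α) = E_α, is continuous from the order topology on ω₁ to the Wijsman topology τ_{w(d)} on CL(X). -/
open Set Topology Ordinal

noncomputable section

/-- A family of points with pairwise distances at least `ε > 0` meets a totally bounded set
for only finitely many indices. -/
theorem TotallyBounded.finite_setOf_mem_of_le_dist {ι X : Type*} [PseudoMetricSpace X]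
    {t : Set X} (ht : TotallyBounded t) {ε : ℝ} (hε : 0 < ε) {s : Set ι} {x : ι → X}
    (hx : ∀ i ∈ s, ∀ j ∈ s, i ≠ j → ε ≤ dist (x i) (x j)) :
    {i ∈ s | x i ∈ t}.Finite := by
  obtain ⟨c, hc, hcover⟩ := Metric.totallyBounded_iff.1 ht (ε / 2) (half_pos hε)
  have h_center : ∀ i ∈ {i ∈ s | x i ∈ t}, ∃ y ∈ c, dist (x i) y < ε / 2 := by
    intro i hi
    simpa using hcover hi.2
  rcases isEmpty_or_nonempty ι with _ | ⟨⟨i₀⟩⟩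
  · exact Set.toFinite _
  have : Nonempty X := ⟨x i₀⟩
  choose! g hgc hg using h_center
  refine Set.Finite.of_finite_image (f := g) (hc.subset (Set.image_subset_iff.2 hgc)) ?_
  intro i hi j hj hij
  by_contra hne
  have hi' := hg i hi
  have hj' := hg j hj
  rw [hij] at hi'
  linarith [hx i hi.1 j hj.1 hne, dist_triangle_right (x i) (x j) (g j)]

/-- Let `(X, d)` be a metric space in which every proper closed ball is totally
bounded and let `x : ω₁ → X` be injective with `ε`-discrete range. With `E₀ = X` and
`E_α = {x_η : α ≤ η < ω₁}` for `0 < α < ω₁`, the map `φ : α ↦ E_α` is continuous from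
the order topology on `ω₁` to the Wijsman topology on `CL X`. -/
theorem phi_continuous_wijsman {X : Type*} [MetricSpace X]
    (h_balls : ∀ (x : X) (r : ℝ), Metric.closedBall x r ≠ Set.univ →
      TotallyBounded (Metric.closedBall x r))
    (ε : ℝ) (hε : 0 < ε) (x : Ordinal → X) (hx_inj : Set.InjOn x (Set.Iio ω₁))
    (hx_disc : ∀ α ∈ Set.Iio ω₁, ∀ β ∈ Set.Iio ω₁, α ≠ β → ε ≤ dist (x α) (x β))
    (φ : {o : Ordinal // o < ω₁} → CL X)
    (hφ_zero : ∀ α : {o : Ordinal // o < ω₁}, α.1 = 0 → (φ α).1 = Set.univ)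
    (hφ_pos : ∀ α : {o : Ordinal // o < ω₁}, α.1 ≠ 0 →
      (φ α).1 = x '' Set.Ico α.1 ω₁) :
    @Continuous _ _ _ (wijsmanTopology X) φ := by
  let _ := wijsmanTopology X
  refine continuous_iInf_rng.2 fun p => continuous_induced_rng.2 ?_
  rw [continuous_iff_continuousAt]
  intro α
  have h_val : Filter.Tendsto (Subtype.val : {o : Ordinal // o < ω₁} → Ordinal) (𝓝 α) (𝓝 α.1) :=
    continuous_subtype_val.tendsto α
  have h_le : ∀ᶠ β in 𝓝 α, β.1 ≤ α.1 :=
    (h_val.eventually (gt_mem_nhds (Order.lt_succ α.1))).mono fun β hβ => Order.lt_succ_iff.1 hβ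
  by_cases hα : α.1 = 0
  · refine tendsto_const_nhds.congr' (h_le.mono fun β hβ => ?_)
    have h_eq : β = α := Subtype.ext (by rw [hα] at hβ ⊢; exact le_antisymm hβ zero_le)
    rw [h_eq]
  have h_pos : ∀ᶠ β in 𝓝 α, β.1 ≠ 0 :=
    (h_val.eventually (lt_mem_nhds (pos_iff_ne_zero.2 hα))).mono fun β hβ => hβ.ne'
  refine tendsto_order.2 ⟨fun a ha => ?_, fun a ha => ?_⟩
  · obtain ⟨c, hac, hc⟩ := exists_between ha
    have h_notMem : ∀ η, α.1 ≤ η → η < ω₁ → x η ∉ Metric.closedBall p c := by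
      intro η hη hη' h_mem
      have h_dist : Metric.infDist p (φ α).1 ≤ dist p (x η) :=
        Metric.infDist_le_dist_of_mem (by rw [hφ_pos α hα]; exact ⟨η, ⟨hη, hη'⟩, rfl⟩)
      rw [Metric.mem_closedBall'] at h_mem
      exact (hc.trans_le h_dist).not_ge h_mem
    have h_ball : Metric.closedBall p c ≠ Set.univ := fun h =>
      h_notMem α.1 le_rfl α.2 (h ▸ Set.mem_univ _)
    have h_fin := (h_balls p c h_ball).finite_setOf_mem_of_le_dist hε hx_disc
    have h_gt : ∀ᶠ β in 𝓝 α, ∀ η ∈ {η ∈ Set.Iio ω₁ | x η ∈ Metric.closedBall p c}, η < β.1 :=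
      (Filter.eventually_all_finite h_fin).2 fun η hη =>
        h_val.eventually (lt_mem_nhds (not_le.1 fun h => h_notMem η h hη.1 hη.2))
    filter_upwards [h_pos, h_gt] with β hβ h_lt
    refine hac.trans_le ((Metric.le_infDist (φ β).2.1).2 fun {y} hy => ?_)
    rw [hφ_pos β hβ] at hy
    obtain ⟨η, hη, rfl⟩ := hy
    by_contra! h
    exact (h_lt η ⟨hη.2, Metric.mem_closedBall'.2 h.le⟩).not_ge hη.1
  · filter_upwards [h_pos, h_le] with β hβ hβα
    refine (Metric.infDist_le_infDist_of_subset ?_ (φ α).2.1).trans_lt ha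
    rw [hφ_pos α hα, hφ_pos β hβ]
    exact Set.image_mono (Set.Ico_subset_Ico_left hβα)
end
end

section
/- Let (X,d) be a metric space such that every closed ball in X that is a proper subset of X is totally bounded. If (X,d) is not separable, then the hyperspace (CL(X), τ_{w(d)}) with the Wijsman topology is not a normal topological space. -/
open Set Topology Ordinal

noncomputable section

open Filter in
/-- A sequence whose terms stay a fixed positive distance apart meets a totally bounded set
only finitely often. -/
theorem TotallyBounded.eventually_notMem_of_separated {X : Type*} [PseudoMetricSpace X]
    {u : ℕ → X} {ε : ℝ} (hε : 0 < ε) (hu : Pairwise fun m n => ε ≤ dist (u m) (u n))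
    {s : Set X} (hs : TotallyBounded s) : ∀ᶠ n in atTop, u n ∉ s := by
  rw [← Nat.cofinite_eq_atTop, eventually_cofinite]
  simp only [not_not]
  by_contra hinf
  obtain ⟨t, ht, hst⟩ := Metric.totallyBounded_iff.1 hs (ε / 2) (half_pos hε)
  have hcov : ∀ n : ℕ, ∃ y : X, u n ∈ s → y ∈ t ∧ dist (u n) y < ε / 2 := fun n => by
    by_cases hn : u n ∈ s
    · obtain ⟨y, hy, hny⟩ := mem_iUnion₂.1 (hst hn)
      exact ⟨y, fun _ => ⟨hy, hny⟩⟩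
    · exact ⟨u n, fun h => absurd h hn⟩
  choose f hf using hcov
  obtain ⟨m, hm, n, hn, hmn, hfmn⟩ :=
    Set.Infinite.exists_ne_map_eq_of_mapsTo hinf (fun n hn => (hf n hn).1) ht
  have h₁ := (hf m hm).2
  have h₂ := (hf n hn).2
  rw [← hfmn] at h₂
  have := dist_triangle_right (u m) (u n) (f m)
  have := hu hmn
  linarith

/-- A space that is not totally bounded contains an infinite uniformly separated sequence. -/
theorem exists_separated_seq_of_not_totallyBounded {X : Type*} [PseudoMetricSpace X]
    (h : ¬ TotallyBounded (univ : Set X)) :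
    ∃ ε > 0, ∃ u : ℕ → X, Pairwise fun m n => ε ≤ dist (u m) (u n) := by
  rw [Metric.totallyBounded_iff] at h
  push Not at h
  obtain ⟨ε, hε, h⟩ := h
  have : Std.Symm fun x y : X => ε ≤ dist x y := ⟨fun x y hxy => by rwa [dist_comm]⟩
  obtain ⟨u, -, hu⟩ := exists_seq_of_forall_finset_exists' (fun _ : X => True)
    (fun x y => ε ≤ dist x y) fun s _ => by
      obtain ⟨y, -, hy⟩ := not_subset.1 (h s s.finite_toSet)
      refine ⟨y, trivial, fun x hx => ?_⟩
      by_contra! hxy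
      exact hy (mem_iUnion₂.2 ⟨x, hx, by rwa [Metric.mem_ball, dist_comm]⟩)
  exact ⟨ε, hε, u, hu⟩

/-- If all proper closed balls are totally bounded and the space is not separable, then for any
countable set of centers some point is at maximal distance from all of them. -/
theorem exists_forall_dist_le_dist_of_not_separable {X : Type*} [PseudoMetricSpace X]
    (h_balls : ∀ (x : X) (r : ℝ), Metric.closedBall x r ≠ Set.univ →
      TotallyBounded (Metric.closedBall x r))
    (h_nonsep : ¬ TopologicalSpace.SeparableSpace X) {C : Set X} (hC : C.Countable) :
    ∃ z, ∀ x ∈ C, ∀ y, dist x y ≤ dist x z := by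
  by_contra! hz
  have := hC.to_subtype
  refine h_nonsep (TopologicalSpace.isSeparable_univ_iff.1 ?_)
  have hsep : TopologicalSpace.IsSeparable
      (⋃ x : C, ⋃ q : ℚ, ⋃ _ : Metric.closedBall x.1 (q : ℝ) ≠ Set.univ,
        Metric.closedBall x.1 (q : ℝ)) :=
    .iUnion fun x => .iUnion fun q => .iUnion fun hq => (h_balls x q hq).isSeparable
  refine hsep.mono fun z _ => ?_
  obtain ⟨x, hx, y, hy⟩ := hz z
  obtain ⟨q, hzq, hqy⟩ := exists_rat_btwn hy
  simp only [mem_iUnion]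
  refine ⟨⟨x, hx⟩, q, fun hq => ?_, ?_⟩
  · have hmem : y ∈ Metric.closedBall x (q : ℝ) := hq ▸ Set.mem_univ y
    rw [Metric.mem_closedBall, dist_comm] at hmem
    linarith
  · rw [Metric.mem_closedBall, dist_comm]
    exact hzq.le

namespace CL

variable {X : Type*} [MetricSpace X]

attribute [local instance] wijsmanTopology

/-- The distance functionals of a closed set, as a point of `X → ℝ`. -/
def distFun (A : CL X) (x : X) : ℝ := Metric.infDist x A.1

theorem isInducing_distFun : IsInducing (distFun : CL X → X → ℝ) := by
  constructor
  simp only [wijsmanTopology, Pi.topologicalSpace, induced_iInf, induced_compose]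
  rfl

theorem distFun_injective : Function.Injective (distFun : CL X → X → ℝ) := by
  intro A B h
  refine Subtype.ext (Set.ext fun x => ?_)
  rw [A.2.2.mem_iff_infDist_zero A.2.1, B.2.2.mem_iff_infDist_zero B.2.1]
  exact Eq.congr_left (congrFun h x)

instance : T2Space (CL X) :=
  (IsEmbedding.mk isInducing_distFun distFun_injective).t2Space

/-- A Wijsman neighborhood only constrains the distances from finitely many points. -/
theorem exists_finset_of_mem_nhds {A : CL X} {U : Set (CL X)} (hU : U ∈ 𝓝 A) :
    ∃ I : Finset X, ∀ B : CL X, (∀ x ∈ I, distFun B x = distFun A x) → B ∈ U := by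
  rw [isInducing_distFun.nhds_eq_comap, Filter.mem_comap] at hU
  obtain ⟨V, hV, hVU⟩ := hU
  rw [nhds_pi, Filter.mem_pi'] at hV
  obtain ⟨I, t, ht, htV⟩ := hV
  refine ⟨I, fun B hB => hVU (htV fun x hx => ?_)⟩
  rw [hB x hx]
  exact mem_of_mem_nhds (ht x)

/-- The closed set `{x, y}`. -/
def pair (x y : X) : CL X := ⟨{x, y}, ⟨x, by simp⟩, (Set.toFinite _).isClosed⟩

theorem distFun_pair (x y w : X) : distFun (pair x y) w = min (dist w x) (dist w y) := by
  have hne : ({x, y} : Set X).Nonempty := ⟨x, by simp⟩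
  refine le_antisymm (le_min (Metric.infDist_le_dist_of_mem (by simp [pair]))
    (Metric.infDist_le_dist_of_mem (by simp [pair]))) ?_
  refine (Metric.le_infDist hne).2 fun v hv => ?_
  rcases hv with rfl | rfl
  · exact min_le_left _ _
  · exact min_le_right _ _

end CL

/-- If `(X, d)` is a non-separable metric space in which every closed ball that is a
proper subset of `X` is totally bounded, then `(CL X, τ_{w(d)})` is not normal. -/
theorem wijsman_nonSeparable_not_normal {X : Type*} [MetricSpace X]
    (h_balls : ∀ (x : X) (r : ℝ), Metric.closedBall x r ≠ Set.univ →
      TotallyBounded (Metric.closedBall x r))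
    (h_nonsep : ¬ TopologicalSpace.SeparableSpace X) :
    ¬ @NormalSpace (CL X) (wijsmanTopology X) := by
  let _ := wijsmanTopology X
  intro hnormal
  obtain ⟨ε, hε, u, hu⟩ := exists_separated_seq_of_not_totallyBounded fun h =>
    h_nonsep (TopologicalSpace.isSeparable_univ_iff.1 h.isSeparable)
  have hfar : ∀ (x y : X) (r : ℝ), r < dist x y → ∀ᶠ n in Filter.atTop, r < dist x (u n) := by
    intro x y r hr
    have hne : Metric.closedBall x r ≠ Set.univ := fun h => by
      have hy : y ∈ Metric.closedBall x r := h ▸ Set.mem_univ y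
      rw [Metric.mem_closedBall, dist_comm] at hy
      linarith
    filter_upwards [(h_balls x r hne).eventually_notMem_of_separated hε hu] with n hn
    rwa [Metric.mem_closedBall, dist_comm, not_le] at hn
  have hinj : Function.Injective fun n => CL.pair (u n) (u n) := by
    intro m n hmn
    by_contra hne
    have h := congrFun (congrArg CL.distFun hmn) (u m)
    simp only [CL.distFun_pair, dist_self, min_self] at h
    have := hu hne
    linarith
  have hlf : LocallyFinite fun n => ({CL.pair (u n) (u n)} : Set (CL X)) := by
    intro A
    obtain ⟨a, ha⟩ := A.2.1
    have hX : Nontrivial X := ⟨u 0, u 1, fun h => by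
      have h01 : ε ≤ dist (u 0) (u 1) := hu zero_ne_one
      rw [h, dist_self] at h01
      linarith⟩
    obtain ⟨y, hy⟩ := exists_ne a
    have hpos : 0 < dist a y := dist_pos.2 hy.symm
    have hcont : Continuous fun B : CL X => CL.distFun B a :=
      (continuous_apply a).comp CL.isInducing_distFun.continuous
    refine ⟨{B | CL.distFun B a < dist a y / 2},
      (isOpen_lt hcont continuous_const).mem_nhds ?_, ?_⟩
    · have h0 : CL.distFun A a = 0 := Metric.infDist_zero_of_mem ha
      rw [mem_ofPred_eq, h0]
      exact half_pos hpos
    · have hev := hfar a y (dist a y / 2) (half_lt_self hpos)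
      rw [← Nat.cofinite_eq_atTop, Filter.eventually_cofinite] at hev
      refine hev.subset ?_
      rintro n ⟨B, rfl, hB⟩
      rw [mem_ofPred_eq, CL.distFun_pair, min_self] at hB
      exact not_lt.2 hB.le
  have hemb : IsClosedEmbedding fun n => CL.pair (u n) (u n) := by
    refine .of_continuous_injective_isClosedMap continuous_of_discreteTopology hinj
      fun s _ => ?_
    have himage : (fun n => CL.pair (u n) (u n)) '' s =
        ⋃ n : s, {CL.pair (u n) (u n)} := by
      ext B
      simp [eq_comm]
    rw [himage]
    exact (hlf.comp_injective Subtype.val_injective).isClosed_iUnion fun _ => isClosed_singleton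
  obtain ⟨F, hF⟩ := ContinuousMap.exists_extension hemb
    (⟨fun n : ℕ => (n : ℝ), continuous_of_discreteTopology⟩ : C(ℕ, ℝ))
  have hFn : ∀ n : ℕ, F (CL.pair (u n) (u n)) = n := fun n => DFunLike.congr_fun hF n
  have hnhds : ∀ n : ℕ, {B | (n : ℝ) - 1 < F B} ∈ 𝓝 (CL.pair (u n) (u n)) := fun n =>
    (isOpen_lt continuous_const F.continuous).mem_nhds (by rw [mem_ofPred_eq, hFn]; linarith)
  choose I hI using fun n => CL.exists_finset_of_mem_nhds (hnhds n)
  obtain ⟨z, hz⟩ := exists_forall_dist_le_dist_of_not_separable h_balls h_nonsep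
    (countable_iUnion fun n => (I n).countable_toSet)
  have hlarge : ∀ n : ℕ, (n : ℝ) - 1 < F (CL.pair (u n) z) := fun n =>
    hI n _ fun x hx => by
      rw [CL.distFun_pair, CL.distFun_pair, min_self,
        min_eq_left (hz x (mem_iUnion.2 ⟨n, hx⟩) _)]
  have hlim : Filter.Tendsto (fun n => CL.pair (u n) z) Filter.atTop (𝓝 (CL.pair z z)) := by
    rw [CL.isInducing_distFun.tendsto_nhds_iff, tendsto_pi_nhds]
    intro x
    simp only [Function.comp_apply, CL.distFun_pair, min_self]
    refine tendsto_order.2 ⟨fun r hr => ?_, fun r hr => ?_⟩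
    · filter_upwards [hfar x z r hr] with n hn using lt_min hn hr
    · exact .of_forall fun n => (min_le_right _ _).trans_lt hr
  refine not_tendsto_nhds_of_tendsto_atTop ?_ _ ((F.continuous.tendsto _).comp hlim)
  refine Filter.tendsto_atTop_mono (fun n => (hlarge n).le) ?_
  exact Filter.tendsto_atTop_add_const_right _ (-1) tendsto_natCast_atTop_atTop
end
end
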